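/- arXiv:2605.11833 — 8 statements merged into one kernel-verified Lean document; each statement's English description precedes it below -/
import Mathlib

section
/- Isomorphism theorem for attractors (Theorem 4.6, stated via intersection patterns of copies, which encode the isomorphism of the P-sprouts at all levels): Let X and X̃ be complete metric spaces and let S_i : X → X and S̃_i : X̃ → X̃ (i ∈ I = {1,…,m}) be two systems of injective contraction maps with attractors K and K̃. Assume K and K̃ are connected, and assume that for every n ≥ 1 and all words u, v of length n over I: (a) K_u ∩ K_v has at most one point and K̃_u ∩ K̃_v has at most one point whenever u ≠ v, and (b) K_u ∩ K_v ≠ ∅ if and only if K̃_u ∩ K̃_v ≠ ∅. Then there is a homeomorphism f : K → K̃ such that f(S_i(x)) = S̃_i(f(x)) for every x ∈ K and every i ∈ I. -/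
/-- `SWord S w` is the composition `S_{i₁} ∘ ⋯ ∘ S_{iₙ}` for the word `w = i₁…iₙ`
(the identity for the empty word). -/
def SWord {X : Type*} {m : ℕ} (S : Fin m → X → X) : List (Fin m) → X → X
  | [] => id
  | i :: w => S i ∘ SWord S w

/-- The points `x` and `y` have a common address of every length: for every `n` some word of
length `n` gives copies containing `x` and `y`. -/
def CommonAddress {X X' : Type*} {m : ℕ} (S : Fin m → X → X) (S' : Fin m → X' → X')
    (K : Set X) (K' : Set X') (x : X) (y : X') : Prop :=
  ∀ n : ℕ, ∃ w : List (Fin m), w.length = n ∧ x ∈ SWord S w '' K ∧ y ∈ SWord S' w '' K'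

/-- The word of the first `n` letters of the itinerary of `x`, where `i x` is the current letter
and `q` moves to the next point. -/
def itinerary {α : Type*} {m : ℕ} (i : α → Fin m) (q : α → α) : ℕ → α → List (Fin m)
  | 0, _ => []
  | n + 1, x => i x :: itinerary i q n (q x)

theorem length_itinerary {α : Type*} {m : ℕ} (i : α → Fin m) (q : α → α) (n : ℕ) (x : α) :
    (itinerary i q n x).length = n := by
  induction n generalizing x with
  | zero => rfl
  | succ n ih => simp [itinerary, ih]

theorem SWord_cons_image {X : Type*} {m : ℕ} (S : Fin m → X → X) (i : Fin m)
    (w : List (Fin m)) (A : Set X) : SWord S (i :: w) '' A = S i '' (SWord S w '' A) := by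
  rw [SWord, Set.image_comp]

theorem mem_SWord_itinerary {X : Type*} {m : ℕ} {S : Fin m → X → X} {K : Set X}
    {i : K → Fin m} {q : K → K} (h : ∀ x : K, S (i x) (q x) = x) (n : ℕ) (x : K) :
    (x : X) ∈ SWord S (itinerary i q n x) '' K := by
  induction n generalizing x with
  | zero => exact ⟨x, x.2, rfl⟩
  | succ n ih =>
    rw [itinerary, SWord_cons_image]
    exact ⟨q x, ih (q x), h x⟩

theorem SWord_itinerary_succ_subset {α X : Type*} {m : ℕ} {S : Fin m → X → X} {K : Set X}
    (hS : ∀ j, S j '' K ⊆ K) (i : α → Fin m) (q : α → α) (n : ℕ) (x : α) :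
    SWord S (itinerary i q (n + 1) x) '' K ⊆ SWord S (itinerary i q n x) '' K := by
  induction n generalizing x with
  | zero => simpa [itinerary, SWord] using hS (i x)
  | succ n ih =>
    simp only [itinerary, SWord_cons_image] at ih ⊢
    exact Set.image_mono (ih (q x))

theorem continuous_SWord {X : Type*} [TopologicalSpace X] {m : ℕ} {S : Fin m → X → X}
    (hS : ∀ j, Continuous (S j)) (w : List (Fin m)) : Continuous (SWord S w) := by
  induction w with
  | nil => exact continuous_id
  | cons i w ih => exact (hS i).comp ih

theorem lipschitzWith_SWord {X : Type*} [PseudoEMetricSpace X] {m : ℕ} {S : Fin m → X → X}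
    {c : NNReal} (hS : ∀ j, LipschitzWith c (S j)) (w : List (Fin m)) :
    LipschitzWith (c ^ w.length) (SWord S w) := by
  induction w with
  | nil => simpa [SWord] using LipschitzWith.id
  | cons i w ih =>
    rw [List.length_cons, pow_succ']
    exact (hS i).comp ih

/-- Finitely many contractions have a common contraction constant. -/
theorem exists_uniform_contraction {X : Type*} [PseudoEMetricSpace X] {m : ℕ}
    {S : Fin m → X → X} {r : Fin m → NNReal} (hr : ∀ i, r i < 1)
    (hlip : ∀ i, LipschitzWith (r i) (S i)) :
    ∃ c : NNReal, c < 1 ∧ ∀ i, LipschitzWith c (S i) :=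
  ⟨Finset.univ.sup r, (Finset.sup_lt_iff (by simp)).2 fun i _ => hr i,
    fun i => (hlip i).weaken (Finset.le_sup (Finset.mem_univ i))⟩

theorem eq_of_forall_SWord_inter_nonempty {X : Type*} [MetricSpace X] {m : ℕ}
    {S : Fin m → X → X} {c : NNReal} (hc : c < 1) (hS : ∀ j, LipschitzWith c (S j))
    {K : Set X} (hK : Bornology.IsBounded K) {y z : X}
    (h : ∀ n : ℕ, 1 ≤ n → ∃ u v : List (Fin m), u.length = n ∧ v.length = n ∧
      y ∈ SWord S u '' K ∧ z ∈ SWord S v '' K ∧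
      (SWord S u '' K ∩ SWord S v '' K).Nonempty) : y = z := by
  obtain ⟨D, hD⟩ := Metric.isBounded_iff.1 hK
  have key : ∀ (w : List (Fin m)) (a b : X), a ∈ SWord S w '' K → b ∈ SWord S w '' K →
      dist a b ≤ (c : ℝ) ^ w.length * D := by
    rintro w _ _ ⟨a, ha, rfl⟩ ⟨b, hb, rfl⟩
    refine ((lipschitzWith_SWord hS w).dist_le_mul a b).trans ?_
    push_cast
    exact mul_le_mul_of_nonneg_left (hD ha hb) (by positivity)
  have hlim : Filter.Tendsto (fun n : ℕ => (c : ℝ) ^ n * D + (c : ℝ) ^ n * D) Filter.atTop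
      (nhds 0) := by
    have h0 := (tendsto_pow_atTop_nhds_zero_of_lt_one c.coe_nonneg
      (by exact_mod_cast hc : (c : ℝ) < 1)).mul_const D
    simpa using h0.add h0
  refine dist_le_zero.1 (ge_of_tendsto hlim ?_)
  filter_upwards [Filter.eventually_ge_atTop 1] with n hn
  obtain ⟨u, v, hu, hv, hy, hz, p, hpu, hpv⟩ := h n hn
  calc dist y z ≤ dist y p + dist p z := dist_triangle _ _ _
    _ ≤ _ := add_le_add (hu ▸ key u y p hy hpu) (hv ▸ key v p z hpv hz)

namespace CommonAddress

variable {X X' : Type*} {m : ℕ} {S : Fin m → X → X} {S' : Fin m → X' → X'}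
  {K : Set X} {K' : Set X'}

theorem symm {x : X} {y : X'} (h : CommonAddress S S' K K' x y) :
    CommonAddress S' S K' K y x := fun n =>
  let ⟨w, hw, hx, hy⟩ := h n
  ⟨w, hw, hy, hx⟩

theorem right_mem {x : X} {y : X'} (h : CommonAddress S S' K K' x y) : y ∈ K' := by
  obtain ⟨w, hw, -, hy⟩ := h 0
  rw [List.length_eq_zero_iff.1 hw] at hy
  simpa [SWord] using hy

theorem map {x : X} {y : X'} (h : CommonAddress S S' K K' x y) {i : Fin m}
    (hx : S i x ∈ K) (hy : S' i y ∈ K') : CommonAddress S S' K K' (S i x) (S' i y)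
  | 0 => ⟨[], rfl, ⟨_, hx, rfl⟩, ⟨_, hy, rfl⟩⟩
  | n + 1 => by
    obtain ⟨w, hw, hxw, hyw⟩ := h n
    refine ⟨i :: w, by simp [hw], ?_, ?_⟩ <;> rw [SWord_cons_image]
    exacts [Set.mem_image_of_mem _ hxw, Set.mem_image_of_mem _ hyw]

theorem unique [MetricSpace X'] {c : NNReal} (hc : c < 1) (hS' : ∀ j, LipschitzWith c (S' j))
    (hK' : Bornology.IsBounded K')
    (hb : ∀ n : ℕ, 1 ≤ n → ∀ u v : List (Fin m), u.length = n → v.length = n →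
      (SWord S u '' K ∩ SWord S v '' K).Nonempty →
        (SWord S' u '' K' ∩ SWord S' v '' K').Nonempty)
    {x : X} {y z : X'} (hy : CommonAddress S S' K K' x y)
    (hz : CommonAddress S S' K K' x z) : y = z := by
  refine eq_of_forall_SWord_inter_nonempty hc hS' hK' fun n hn => ?_
  obtain ⟨u, hu, hxu, hyu⟩ := hy n
  obtain ⟨v, hv, hxv, hzv⟩ := hz n
  exact ⟨u, v, hu, hv, hyu, hzv, hb n hn u v hu hv ⟨x, hxu, hxv⟩⟩

theorem exists_right [TopologicalSpace X'] [T2Space X'] (hS' : ∀ j, Continuous (S' j))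
    (hK : K ⊆ ⋃ i, S i '' K) (hKne' : K'.Nonempty) (hKcp' : IsCompact K')
    (hK' : ∀ j, S' j '' K' ⊆ K') {x : X} (hx : x ∈ K) :
    ∃ y, CommonAddress S S' K K' x y := by
  have hstep : ∀ p : K, ∃ (i : Fin m) (q : K), S i q = p := by
    intro p
    obtain ⟨i, q, hq, hqp⟩ := Set.mem_iUnion.1 (hK p.2)
    exact ⟨i, ⟨q, hq⟩, hqp⟩
  choose i q hiq using hstep
  have hcp : ∀ n, IsCompact (SWord S' (itinerary i q n ⟨x, hx⟩) '' K') := fun n =>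
    hKcp'.image (continuous_SWord hS' _)
  obtain ⟨y, hy⟩ := IsCompact.nonempty_iInter_of_sequence_nonempty_isCompact_isClosed
    (fun n => SWord S' (itinerary i q n ⟨x, hx⟩) '' K')
    (fun n => SWord_itinerary_succ_subset hK' i q n _) (fun n => hKne'.image _) (hcp 0)
    (fun n => (hcp n).isClosed)
  exact ⟨y, fun n => ⟨_, length_itinerary i q n _, mem_SWord_itinerary hiq n ⟨x, hx⟩,
    Set.mem_iInter.1 hy n⟩⟩

theorem isClosed [TopologicalSpace X] [T2Space X] [TopologicalSpace X'] [T2Space X']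
    (hS : ∀ j, Continuous (S j)) (hS' : ∀ j, Continuous (S' j))
    (hK : IsCompact K) (hK' : IsCompact K') :
    IsClosed {p : X × X' | CommonAddress S S' K K' p.1 p.2} := by
  have h : {p : X × X' | CommonAddress S S' K K' p.1 p.2} =
      ⋂ n : ℕ, ⋃ w ∈ {w : List (Fin m) | w.length = n},
        (SWord S w '' K) ×ˢ (SWord S' w '' K') := by
    ext p
    simp [CommonAddress, and_left_comm]
  rw [h]
  exact isClosed_iInter fun n => (List.finite_length_eq (Fin m) n).isClosed_biUnion fun w _ =>
    (hK.image (continuous_SWord hS w)).isClosed.prod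
      (hK'.image (continuous_SWord hS' w)).isClosed

end CommonAddress

theorem continuous_of_forall_commonAddress {X X' : Type*} [TopologicalSpace X] [T2Space X]
    [TopologicalSpace X'] [T2Space X'] {m : ℕ} {S : Fin m → X → X} {S' : Fin m → X' → X'}
    {K : Set X} {K' : Set X'} (hS : ∀ j, Continuous (S j)) (hS' : ∀ j, Continuous (S' j))
    (hK : IsCompact K) (hK' : IsCompact K') {f : K → K'}
    (hf : ∀ (x : K) (y : K'), f x = y ↔ CommonAddress S S' K K' x y) : Continuous f := by
  have : CompactSpace K' := isCompact_iff_compactSpace.1 hK'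
  refine continuous_iff_isClosed.2 fun C hC => ?_
  have hgraph : IsClosed {p : K × K' | f p.1 = p.2} := by
    simp_rw [hf]
    exact (CommonAddress.isClosed hS hS' hK hK').preimage
      (continuous_subtype_val.prodMap continuous_subtype_val)
  convert isClosedMap_fst_of_compactSpace _ (hgraph.inter (hC.preimage continuous_snd)) using 1
  ext x
  simp

/-- **Isomorphism theorem for attractors** (Theorem 4.6).
If two systems of injective contractions have connected attractors whose copies of
every level have pairwise intersections that are at most singletons and have the same
intersection pattern at every level, then the attractors are isomorphic: there is a
homeomorphism `f : K ≃ₜ K'` conjugating each `S i` to `S' i`. -/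
theorem isomorphism_theorem_for_attractors
    {X X' : Type*} [MetricSpace X] [CompleteSpace X] [MetricSpace X'] [CompleteSpace X']
    {m : ℕ} (S : Fin m → X → X) (S' : Fin m → X' → X')
    (r r' : Fin m → NNReal) (hr : ∀ i, r i < 1) (hr' : ∀ i, r' i < 1)
    (hlip : ∀ i, LipschitzWith (r i) (S i)) (hlip' : ∀ i, LipschitzWith (r' i) (S' i))
    (hinj : ∀ i, Function.Injective (S i)) (hinj' : ∀ i, Function.Injective (S' i))
    (K : Set X) (K' : Set X')
    (hKne : K.Nonempty) (hKcp : IsCompact K) (hKeq : K = ⋃ i, S i '' K)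
    (hKne' : K'.Nonempty) (hKcp' : IsCompact K') (hKeq' : K' = ⋃ i, S' i '' K')
    (hconn : IsConnected K) (hconn' : IsConnected K')
    (ha : ∀ n : ℕ, 1 ≤ n → ∀ u v : List (Fin m), u.length = n → v.length = n → u ≠ v →
      (SWord S u '' K ∩ SWord S v '' K).Subsingleton ∧
        (SWord S' u '' K' ∩ SWord S' v '' K').Subsingleton)
    (hb : ∀ n : ℕ, 1 ≤ n → ∀ u v : List (Fin m), u.length = n → v.length = n →
      ((SWord S u '' K ∩ SWord S v '' K).Nonempty ↔
        (SWord S' u '' K' ∩ SWord S' v '' K').Nonempty)) :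
    ∃ f : K ≃ₜ K', ∀ (x : X) (hx : x ∈ K) (i : Fin m) (hx' : S i x ∈ K),
      (f ⟨S i x, hx'⟩ : X') = S' i (f ⟨x, hx⟩) := by
  obtain ⟨c, hc, hS⟩ := exists_uniform_contraction hr hlip
  obtain ⟨c', hc', hS'⟩ := exists_uniform_contraction hr' hlip'
  have hcont := fun j => (hlip j).continuous
  have hcont' := fun j => (hlip' j).continuous
  have hsub : ∀ j, S j '' K ⊆ K := fun j =>
    (Set.subset_iUnion (fun i => S i '' K) j).trans hKeq.ge
  have hsub' : ∀ j, S' j '' K' ⊆ K' := fun j =>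
    (Set.subset_iUnion (fun i => S' i '' K') j).trans hKeq'.ge
  have hright : ∀ x : K, ∃ y : K', CommonAddress S S' K K' x y := fun x =>
    let ⟨y, hy⟩ := CommonAddress.exists_right hcont' hKeq.le hKne' hKcp' hsub' x.2
    ⟨⟨y, hy.right_mem⟩, hy⟩
  have hleft : ∀ y : K', ∃ x : K, CommonAddress S S' K K' x y := fun y =>
    let ⟨x, hx⟩ := CommonAddress.exists_right hcont hKeq'.le hKne hKcp hsub y.2
    ⟨⟨x, hx.right_mem⟩, hx.symm⟩
  choose f hf using hright
  choose g hg using hleft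
  have hfy : ∀ (x : K) (y : K'), f x = y ↔ CommonAddress S S' K K' x y := fun x y =>
    ⟨fun h => h ▸ hf x, fun h => Subtype.ext <| (hf x).unique hc' hS' hKcp'.isBounded
      (fun n hn u v hu hv => (hb n hn u v hu hv).1) h⟩
  have hgx : ∀ (y : K') (x : K), g y = x ↔ CommonAddress S' S K' K y x := fun y x =>
    ⟨fun h => h ▸ (hg y).symm, fun h => Subtype.ext <| (hg y).symm.unique hc hS hKcp.isBounded
      (fun n hn u v hu hv => (hb n hn u v hu hv).2) h⟩
  refine ⟨{ toFun := f
            invFun := g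
            left_inv := fun x => (hgx _ _).2 (hf x).symm
            right_inv := fun y => (hfy _ _).2 (hg y)
            continuous_toFun :=
              continuous_of_forall_commonAddress hcont hcont' hKcp hKcp' hfy
            continuous_invFun :=
              continuous_of_forall_commonAddress hcont' hcont hKcp' hKcp hgx }, ?_⟩
  intro x hx i hx'
  have hy : S' i (f ⟨x, hx⟩) ∈ K' := hsub' i ⟨_, (f ⟨x, hx⟩).2, rfl⟩
  exact congrArg Subtype.val ((hfy ⟨S i x, hx'⟩ ⟨_, hy⟩).2 ((hf ⟨x, hx⟩).map hx' hy))
end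

section
/- Theorem 5.6(1) (uniformly bounded orders): Let K be the attractor of a system of injective contractions S_i (i ∈ I) on a complete metric space, suppose K is a dendrite and the self-similar boundary ∂K is finite. Assume that the index diagram has no cyclic vertex of outdegree ≥ 2, i.e.: for every p ∈ ∂K such that S_w(p) = p for some nonempty word w over I, there is at most one pair (k, q) ∈ I × ∂K with S_k(q) = p. Then the orders of the points of K are uniformly bounded: there exists M ∈ ℕ such that for every x ∈ K the set of connected components of K \ {x} is finite and has at most M elements. -/
/-- `α : ℕ → Fin m` is an address of `x` if `x ∈ K_{α|n} = S_{α(0)…α(n-1)}(K)`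
for every `n ≥ 1`. -/
def IsAddress {X : Type*} {m : ℕ} (S : Fin m → X → X) (K : Set X) (x : X)
    (α : ℕ → Fin m) : Prop :=
  ∀ n : ℕ, 1 ≤ n → x ∈ SWord S (List.ofFn fun k : Fin n => α k.val) '' K

/-- The critical set `C = ⋃_{i ≠ j} (K_i ∩ K_j)`. -/
def CriticalSet {X : Type*} {m : ℕ} (S : Fin m → X → X) (K : Set X) : Set X :=
  ⋃ (i : Fin m) (j : Fin m) (_ : i ≠ j), (S i '' K) ∩ (S j '' K)

/-- The self-similar boundary
`∂K = {x ∈ K : S_w(x) ∈ C for some nonempty word w}`. -/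
def SSBoundary {X : Type*} {m : ℕ} (S : Fin m → X → X) (K : Set X) : Set X :=
  {x | x ∈ K ∧ ∃ w : List (Fin m), w ≠ [] ∧ SWord S w x ∈ CriticalSet S K}

/-- `K` is a dendrite: compact, connected, locally connected (as a subspace), and
admitting no continuous injection of the unit circle. -/
def IsDendrite {X : Type*} [TopologicalSpace X] (K : Set X) : Prop :=
  IsCompact K ∧ IsConnected K ∧ LocallyConnectedSpace K ∧
    ∀ f : (Metric.sphere (0 : ℂ) 1) → K, Continuous f → ¬ Function.Injective f

/-- The set of connected components of the set `A`. -/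
def ComponentsIn {X : Type*} [TopologicalSpace X] (A : Set X) : Set (Set X) :=
  {C | ∃ y ∈ A, C = connectedComponentIn A y}

/-- The main tree of `K`: the intersection of all closed connected sets `A` with
`∂K ⊆ A ⊆ K`. -/
def MainTree {X : Type*} [TopologicalSpace X] {m : ℕ} (S : Fin m → X → X)
    (K : Set X) : Set X :=
  ⋂₀ {A : Set X | IsClosed A ∧ IsConnected A ∧ SSBoundary S K ⊆ A ∧ A ⊆ K}

section SelfSimilar

variable {X : Type*} {m : ℕ} {S : Fin m → X → X} {K : Set X}

theorem SWord_append (v w : List (Fin m)) (x : X) :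
    SWord S (v ++ w) x = SWord S v (SWord S w x) := by
  induction v with
  | nil => rfl
  | cons i v ih => simp [SWord, ih]

theorem SWord_injective (hinj : ∀ i, Function.Injective (S i)) (w : List (Fin m)) :
    Function.Injective (SWord S w) := by
  induction w with
  | nil => exact Function.injective_id
  | cons i w ih => exact (hinj i).comp ih

theorem SWord_mem (hK : ∀ i, ∀ x ∈ K, S i x ∈ K) (w : List (Fin m)) {x : X} (hx : x ∈ K) :
    SWord S w x ∈ K := by
  induction w with
  | nil => exact hx
  | cons i w ih => exact hK i _ ih

theorem mem_criticalSet {i j : Fin m} (hij : i ≠ j) {y z : X} (hy : y ∈ K) (hz : z ∈ K)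
    (h : S i y = S j z) : S i y ∈ CriticalSet S K := by
  simp only [CriticalSet, Set.mem_iUnion]
  exact ⟨i, j, hij, ⟨y, hy, rfl⟩, ⟨z, hz, h.symm⟩⟩

theorem mem_SSBoundary_of_apply_mem {i : Fin m} {q : X} (hq : q ∈ K)
    (h : S i q ∈ SSBoundary S K) : q ∈ SSBoundary S K := by
  obtain ⟨-, w, -, hw⟩ := h
  refine ⟨hq, w ++ [i], by simp, ?_⟩
  rwa [SWord_append]

/-- Distinct cells of the same level meet only in images of the self-similar boundary. -/
theorem mem_SSBoundary_of_SWord_eq (hinj : ∀ i, Function.Injective (S i))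
    (hK : ∀ i, ∀ x ∈ K, S i x ∈ K) {y z : X} (hy : y ∈ K) (hz : z ∈ K) :
    ∀ {w v : List (Fin m)}, w.length = v.length → w ≠ v → SWord S w y = SWord S v z →
      y ∈ SSBoundary S K
  | [], [], _, hne, _ => absurd rfl hne
  | i :: w, j :: v, hlen, hne, h => by
    by_cases hij : i = j
    · subst hij
      exact mem_SSBoundary_of_SWord_eq hinj hK hy hz (by simpa using hlen)
        (fun e => hne (by rw [e])) (hinj i h)
    · exact ⟨hy, i :: w, by simp,
        mem_criticalSet hij (SWord_mem hK w hy) (SWord_mem hK v hz) h⟩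

/-- The words of length `n` whose cell contains `x`. -/
def cellWords (S : Fin m → X → X) (K : Set X) (n : ℕ) (x : X) : Set (List (Fin m)) :=
  {w | w.length = n ∧ x ∈ SWord S w '' K}

theorem exists_cellWords_zero_subset (x : X) {B : ℕ} (hB : 1 ≤ B) :
    ∃ F : Finset (List (Fin m)), F.card ≤ B ∧ cellWords S K 0 x ⊆ F := by
  refine ⟨{[]}, by simpa using hB, ?_⟩
  rintro w ⟨hw, -⟩
  simpa using hw

theorem exists_cellWords_succ_subset (hinj : ∀ i, Function.Injective (S i))
    (hK : ∀ i, ∀ x ∈ K, S i x ∈ K) (n B : ℕ) (x : X) (T : Finset (Fin m))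
    (hT : ∀ i, ∀ y ∈ K, S i y = x → i ∈ T)
    (h : ∀ i, ∀ y ∈ K, S i y = x →
      ∃ F : Finset (List (Fin m)), F.card ≤ B ∧ cellWords S K n y ⊆ F) :
    ∃ F : Finset (List (Fin m)), F.card ≤ T.card * B ∧ cellWords S K (n + 1) x ⊆ F := by
  classical
  have key : ∀ i, ∃ F : Finset (List (Fin m)), F.card ≤ B ∧
      ∀ y ∈ K, S i y = x → cellWords S K n y ⊆ F := by
    intro i
    by_cases hi : ∃ y ∈ K, S i y = x
    · obtain ⟨y, hy, hyx⟩ := hi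
      obtain ⟨F, hF, hsub⟩ := h i y hy hyx
      refine ⟨F, hF, fun z _ hzx => ?_⟩
      rwa [hinj i (hzx.trans hyx.symm)]
    · exact ⟨∅, by simp, fun y hy hyx => absurd ⟨y, hy, hyx⟩ hi⟩
  choose F hF hsub using key
  refine ⟨T.biUnion fun i => (F i).image (List.cons i),
    Finset.card_biUnion_le_card_mul _ _ _ fun i _ => Finset.card_image_le.trans (hF i), ?_⟩
  rintro (_ | ⟨i, w⟩) ⟨hlen, z, hz, hzx⟩
  · simp at hlen
  · have hzK := SWord_mem hK w hz
    have hw : w ∈ F i := hsub i _ hzK hzx ⟨by simpa using hlen, z, hz, rfl⟩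
    simp only [Finset.coe_biUnion, Set.mem_iUnion, Finset.coe_image, Set.mem_image]
    exact ⟨i, hT i _ hzK hzx, w, hw, rfl⟩

/-- The boundary points that can be reached from `p` in the index diagram. -/
def reachable (S : Fin m → X → X) (K : Set X) (p : X) : Set X :=
  {q | q ∈ SSBoundary S K ∧ ∃ w, SWord S w q = p}

theorem reachable_subset_apply (i : Fin m) (q : X) :
    reachable S K q ⊆ reachable S K (S i q) := by
  rintro x ⟨hx, w, rfl⟩
  exact ⟨hx, i :: w, rfl⟩

theorem exists_cellWords_subset_of_mem_SSBoundary (hinj : ∀ i, Function.Injective (S i))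
    (hK : ∀ i, ∀ x ∈ K, S i x ∈ K) (hm : 0 < m) (hfin : (SSBoundary S K).Finite)
    (hcyc : ∀ p ∈ SSBoundary S K, (∃ w : List (Fin m), w ≠ [] ∧ SWord S w p = p) →
      {kq : Fin m × X | kq.2 ∈ SSBoundary S K ∧ S kq.1 kq.2 = p}.Subsingleton)
    (n : ℕ) : ∀ p ∈ SSBoundary S K, ∃ F : Finset (List (Fin m)),
      F.card ≤ m ^ (reachable S K p).ncard ∧ cellWords S K n p ⊆ F := by
  classical
  induction n with
  | zero => exact fun p _ => exists_cellWords_zero_subset p (Nat.one_le_pow _ _ hm)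
  | succ n ih =>
    intro p hp
    have hrfin : (reachable S K p).Finite := hfin.subset fun q hq => hq.1
    let T : Finset (Fin m) := {i | ∃ y ∈ K, S i y = p}
    have hT : ∀ i, ∀ y ∈ K, S i y = p → i ∈ T := fun i y hy h => by
      simpa [T] using ⟨y, hy, h⟩
    by_cases hcard : 1 < T.card
    · obtain ⟨i, hi, j, hj, hij⟩ := Finset.one_lt_card.1 hcard
      simp only [T, Finset.mem_filter, Finset.mem_univ, true_and] at hi hj
      obtain ⟨y, hy, hyp⟩ := hi
      obtain ⟨z, hz, hzp⟩ := hj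
      have hnc : ¬ ∃ w : List (Fin m), w ≠ [] ∧ SWord S w p = p := fun hw =>
        hij (congrArg Prod.fst (hcyc p hp hw
          (show (i, y) ∈ _ from ⟨mem_SSBoundary_of_apply_mem hy (hyp ▸ hp), hyp⟩)
          (show (j, z) ∈ _ from ⟨mem_SSBoundary_of_apply_mem hz (hzp ▸ hp), hzp⟩)))
      have hpos : 0 < (reachable S K p).ncard :=
        (Set.ncard_pos hrfin).2 ⟨p, hp, [], rfl⟩
      obtain ⟨F, hF, hsub⟩ := exists_cellWords_succ_subset hinj hK n
        (m ^ ((reachable S K p).ncard - 1)) p T hT (fun i q hq hqp => by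
          obtain ⟨F, hF, hsub⟩ := ih q (mem_SSBoundary_of_apply_mem hq (hqp ▸ hp))
          refine ⟨F, hF.trans (Nat.pow_le_pow_right hm (Nat.le_sub_one_of_lt ?_)), hsub⟩
          refine Set.ncard_lt_ncard ⟨hqp ▸ reachable_subset_apply i q, fun hs => ?_⟩ hrfin
          obtain ⟨-, w, hw⟩ := hs (show p ∈ reachable S K p from ⟨hp, [], rfl⟩)
          exact hnc ⟨i :: w, by simp, by simp [SWord, hw, hqp]⟩)
      refine ⟨F, hF.trans ?_, hsub⟩
      calc T.card * m ^ ((reachable S K p).ncard - 1)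
          ≤ m * m ^ ((reachable S K p).ncard - 1) :=
            Nat.mul_le_mul_right _ ((Finset.card_le_univ T).trans_eq (Fintype.card_fin m))
        _ = m ^ (reachable S K p).ncard := by
            rw [← pow_succ', Nat.sub_add_cancel hpos]
    · obtain ⟨F, hF, hsub⟩ := exists_cellWords_succ_subset hinj hK n
        (m ^ (reachable S K p).ncard) p T hT (fun i q hq hqp => by
          obtain ⟨F, hF, hsub⟩ := ih q (mem_SSBoundary_of_apply_mem hq (hqp ▸ hp))
          exact ⟨F, hF.trans (Nat.pow_le_pow_right hm (Set.ncard_le_ncard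
            (hqp ▸ reachable_subset_apply i q) hrfin)), hsub⟩)
      exact ⟨F, hF.trans ((Nat.mul_le_mul_right _ (not_lt.1 hcard)).trans_eq (one_mul _)), hsub⟩

theorem exists_cellWords_subset (hinj : ∀ i, Function.Injective (S i))
    (hK : ∀ i, ∀ x ∈ K, S i x ∈ K) (hm : 0 < m) (hfin : (SSBoundary S K).Finite)
    (hcyc : ∀ p ∈ SSBoundary S K, (∃ w : List (Fin m), w ≠ [] ∧ SWord S w p = p) →
      {kq : Fin m × X | kq.2 ∈ SSBoundary S K ∧ S kq.1 kq.2 = p}.Subsingleton)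
    (n : ℕ) : ∀ x, ∃ F : Finset (List (Fin m)),
      F.card ≤ m * m ^ (SSBoundary S K).ncard ∧ cellWords S K n x ⊆ F := by
  classical
  induction n with
  | zero => exact fun x => exists_cellWords_zero_subset x (Nat.mul_pos hm (Nat.pow_pos hm))
  | succ n ih =>
    intro x
    let T : Finset (Fin m) := {i | ∃ y ∈ K, S i y = x}
    have hT : ∀ i, ∀ y ∈ K, S i y = x → i ∈ T := fun i y hy h => by
      simpa [T] using ⟨y, hy, h⟩
    by_cases hcard : 1 < T.card
    · obtain ⟨i, hi, j, hj, hij⟩ := Finset.one_lt_card.1 hcard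
      simp only [T, Finset.mem_filter, Finset.mem_univ, true_and] at hi hj
      obtain ⟨y, hy, hyx⟩ := hi
      obtain ⟨z, hz, hzx⟩ := hj
      have hx : x ∈ CriticalSet S K := hyx ▸ mem_criticalSet hij hy hz (hyx.trans hzx.symm)
      obtain ⟨F, hF, hsub⟩ := exists_cellWords_succ_subset hinj hK n
        (m ^ (SSBoundary S K).ncard) x T hT (fun k q hq hqx => by
          obtain ⟨F, hF, hsub⟩ := exists_cellWords_subset_of_mem_SSBoundary hinj hK hm hfin hcyc n
            q ⟨hq, [k], by simp, by simpa [SWord, hqx] using hx⟩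
          exact ⟨F, hF.trans (Nat.pow_le_pow_right hm
            (Set.ncard_le_ncard (fun _ h => h.1) hfin)), hsub⟩)
      exact ⟨F, hF.trans (Nat.mul_le_mul_right _
        ((Finset.card_le_univ T).trans_eq (Fintype.card_fin m))), hsub⟩
    · obtain ⟨F, hF, hsub⟩ := exists_cellWords_succ_subset hinj hK n
        (m * m ^ (SSBoundary S K).ncard) x T hT (fun _ q _ _ => ih q)
      exact ⟨F, hF.trans ((Nat.mul_le_mul_right _ (not_lt.1 hcard)).trans_eq (one_mul _)), hsub⟩

theorem exists_SWord_eq (hKeq : K = ⋃ i, S i '' K) (n : ℕ) :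
    ∀ x ∈ K, ∃ w : List (Fin m), w.length = n ∧ x ∈ SWord S w '' K := by
  induction n with
  | zero => exact fun x hx => ⟨[], rfl, x, hx, rfl⟩
  | succ n ih =>
    intro x hx
    rw [hKeq] at hx
    obtain ⟨i, y, hy, rfl⟩ := Set.mem_iUnion.1 hx
    obtain ⟨w, hw, z, hz, rfl⟩ := ih y hy
    exact ⟨i :: w, by simp [hw], z, hz, rfl⟩

end SelfSimilar

theorem SWord_lipschitzWith {X : Type*} [MetricSpace X] {m : ℕ} {S : Fin m → X → X}
    {ρ : NNReal} (h : ∀ i, LipschitzWith ρ (S i)) (w : List (Fin m)) :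
    LipschitzWith (ρ ^ w.length) (SWord S w) := by
  induction w with
  | nil => simpa [SWord] using (LipschitzWith.id : LipschitzWith 1 (id : X → X))
  | cons i w ih => simpa [SWord, pow_succ'] using (h i).comp ih

/-- In a locally connected continuum, every component of the complement of a point accumulates
at that point. -/
theorem mem_closure_of_mem_componentsIn {X : Type*} [TopologicalSpace X] [T1Space X] {K : Set X}
    (hcl : IsClosed K) (hconn : IsConnected K) [LocallyConnectedSpace K] {x : X} (hx : x ∈ K)
    {C : Set X} (hC : C ∈ ComponentsIn (K \ {x})) : x ∈ closure C := by
  obtain ⟨y, hy, rfl⟩ := hC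
  by_contra hxC
  set C := connectedComponentIn (K \ {x}) y with hCdef
  have hCsub : C ⊆ K \ {x} := connectedComponentIn_subset _ _
  have hyC : y ∈ C := mem_connectedComponentIn hy
  have hCK : closure C ⊆ K := closure_minimal (hCsub.trans Set.sdiff_subset) hcl
  have hclosed : closure C ⊆ C := by
    refine isPreconnected_connectedComponentIn.closure.subset_connectedComponentIn
      (subset_closure hyC) fun z hz => ⟨hCK hz, ?_⟩
    rintro rfl
    exact hxC hz
  have hopen : IsOpen ((↑) ⁻¹' C : Set K) := by
    rw [isOpen_iff_mem_nhds]
    intro z hz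
    have hzx : ({⟨x, hx⟩}ᶜ : Set K) ∈ nhds z := isOpen_compl_singleton.mem_nhds fun h =>
      (hCsub hz).2 (congrArg Subtype.val h)
    obtain ⟨V, ⟨hVo, hzV, hVc⟩, hVsub⟩ :=
      (LocallyConnectedSpace.open_connected_basis z).mem_iff.1 hzx
    refine Filter.mem_of_superset (hVo.mem_nhds hzV) fun v hv => ?_
    have hsub : ((↑) '' V : Set X) ⊆ connectedComponentIn (K \ {x}) z :=
      (hVc.isPreconnected.image _ continuous_subtype_val.continuousOn).subset_connectedComponentIn
        ⟨z, hzV, rfl⟩ (by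
          rintro _ ⟨u, hu, rfl⟩
          exact ⟨u.2, fun h => hVsub hu (Subtype.ext h)⟩)
    rw [← connectedComponentIn_eq hz] at hsub
    exact hsub ⟨v, hv, rfl⟩
  have hclopen : IsClopen ((↑) ⁻¹' C : Set K) :=
    ⟨(isClosed_of_closure_subset hclosed).preimage continuous_subtype_val, hopen⟩
  have : PreconnectedSpace K := Subtype.preconnectedSpace hconn.isPreconnected
  have huniv := hclopen.eq_univ ⟨⟨y, hy.1⟩, hyC⟩
  have hxmem : (⟨x, hx⟩ : K) ∈ ((↑) ⁻¹' C : Set K) := huniv ▸ Set.mem_univ _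
  exact (hCsub hxmem).2 rfl

theorem eq_of_mem_componentsIn {X : Type*} [TopologicalSpace X] {A C D : Set X}
    (hC : C ∈ ComponentsIn A) (hD : D ∈ ComponentsIn A) {z : X} (hzC : z ∈ C) (hzD : z ∈ D) :
    C = D := by
  obtain ⟨y, -, rfl⟩ := hC
  obtain ⟨y', -, rfl⟩ := hD
  rw [connectedComponentIn_eq hzC, connectedComponentIn_eq hzD]

/-- If no point lies in more than `B` cells of any given level, then the order of every point is
bounded in terms of `B` and the cardinality of the self-similar boundary. -/
theorem card_le_of_subset_componentsIn {X : Type*} [MetricSpace X] {m : ℕ} {S : Fin m → X → X}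
    {ρ : NNReal} (hρ : ρ < 1) (hlip : ∀ i, LipschitzWith ρ (S i))
    (hinj : ∀ i, Function.Injective (S i)) {K : Set X} (hKcp : IsCompact K)
    (hKeq : K = ⋃ i, S i '' K) (hconn : IsConnected K) [LocallyConnectedSpace K]
    (hfin : (SSBoundary S K).Finite) {B : ℕ} {x : X} (hx : x ∈ K)
    (hB : ∀ n, ∃ F : Finset (List (Fin m)), F.card ≤ B ∧ cellWords S K n x ⊆ F)
    (T : Finset (Set X)) (hT : ↑T ⊆ ComponentsIn (K \ {x})) :
    T.card ≤ B * (SSBoundary S K).ncard := by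
  classical
  have hK : ∀ i, ∀ x ∈ K, S i x ∈ K := fun i x hx => by
    rw [hKeq]; exact Set.mem_iUnion.2 ⟨i, x, hx, rfl⟩
  have : Nonempty X := ⟨x⟩
  have hpt : ∀ C ∈ T, ∃ y ∈ C, y ∈ K \ {x} := fun C hC => by
    obtain ⟨y, hy, rfl⟩ := hT hC
    exact ⟨y, mem_connectedComponentIn hy, hy⟩
  choose! y hyC hyK using hpt
  have hsmall : ∃ n : ℕ, ∀ C ∈ T, (ρ : ℝ) ^ n * Metric.diam K < dist (y C) x := by
    have htend : Filter.Tendsto (fun n : ℕ => (ρ : ℝ) ^ n * Metric.diam K) Filter.atTop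
        (nhds 0) := by
      simpa using (tendsto_pow_atTop_nhds_zero_of_lt_one ρ.coe_nonneg
        (by exact_mod_cast hρ)).mul_const (Metric.diam K)
    exact ((Filter.eventually_all_finset T).2 fun C hC =>
      htend.eventually_lt_const (dist_pos.2 (hyK C hC).2)).exists
  obtain ⟨n, hn⟩ := hsmall
  obtain ⟨F, hFcard, hF⟩ := hB n
  have hwfin : {w : List (Fin m) | w.length = n}.Finite := List.finite_length_eq _ n
  have hcellclosed : ∀ w : List (Fin m), IsClosed (SWord S w '' K) := fun w =>
    (hKcp.image (SWord_lipschitzWith hlip w).continuous).isClosed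
  let A : Set X := ⋃ w ∈ cellWords S K n x, SWord S w '' K
  let A' : Set X := ⋃ w ∈ {w | w.length = n} \ cellWords S K n x, SWord S w '' K
  have hA : IsClosed A :=
    (hwfin.subset fun w hw => hw.1).isClosed_biUnion fun w _ => hcellclosed w
  have hA' : IsClosed A' := hwfin.sdiff.isClosed_biUnion fun w _ => hcellclosed w
  have hcover : K ⊆ A ∪ A' := fun z hz => by
    obtain ⟨w, hw, hzw⟩ := exists_SWord_eq hKeq n z hz
    by_cases hwx : w ∈ cellWords S K n x
    · exact Or.inl (Set.mem_biUnion hwx hzw)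
    · exact Or.inr (Set.mem_biUnion (show w ∈ _ \ _ from ⟨hw, hwx⟩) hzw)
  have hxA' : x ∉ A' := fun h => by
    obtain ⟨w, ⟨hw, hwx⟩, hxw⟩ := Set.mem_iUnion₂.1 h
    exact hwx ⟨hw, hxw⟩
  have hyA : ∀ C ∈ T, y C ∉ A := fun C hC h => by
    obtain ⟨w, ⟨hw, b, hb, hbx⟩, a, ha, hay⟩ := Set.mem_iUnion₂.1 h
    have hd := (SWord_lipschitzWith hlip w).dist_le_mul a b
    rw [hay, hbx, hw] at hd
    push_cast at hd
    have hab := Metric.dist_le_diam_of_mem hKcp.isBounded ha hb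
    exact absurd (hd.trans (mul_le_mul_of_nonneg_left hab (by positivity))) (not_le.2 (hn C hC))
  have hcross : ∀ C ∈ T, ∃ z ∈ C, ∃ w ∈ cellWords S K n x, ∃ q ∈ SSBoundary S K,
      SWord S w q = z := fun C hC => by
    have hxC := mem_closure_of_mem_componentsIn hKcp.isClosed hconn hx (hT hC)
    have hCpre : IsPreconnected C := by
      obtain ⟨y, -, rfl⟩ := hT hC
      exact isPreconnected_connectedComponentIn
    have hCK : C ⊆ K := by
      obtain ⟨y, -, rfl⟩ := hT hC
      exact (connectedComponentIn_subset _ _).trans Set.sdiff_subset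
    have hCA : (C ∩ A).Nonempty := by
      by_contra hne
      refine hxA' (closure_minimal (fun z hz => ?_) hA' hxC)
      exact (hcover (hCK hz)).resolve_left fun hzA => hne ⟨z, hz, hzA⟩
    have hCA' : (C ∩ A').Nonempty :=
      ⟨y C, hyC C hC, (hcover (hyK C hC).1).resolve_left (hyA C hC)⟩
    obtain ⟨z, hzC, hzA, hzA'⟩ := isPreconnected_closed_iff.1 hCpre A A' hA hA'
      (hCK.trans hcover) hCA hCA'
    obtain ⟨w, hw, a, ha, haz⟩ := Set.mem_iUnion₂.1 hzA
    obtain ⟨v, hv, b, hb, hbz⟩ := Set.mem_iUnion₂.1 hzA'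
    refine ⟨z, hzC, w, hw, a, ?_, haz⟩
    refine mem_SSBoundary_of_SWord_eq hinj hK ha hb (hw.1.trans hv.1.symm) ?_
      (haz.trans hbz.symm)
    rintro rfl
    exact hv.2 hw
  choose! z hzC w hw q hq hz using hcross
  calc T.card ≤ (F ×ˢ hfin.toFinset).card := by
        refine Finset.card_le_card_of_injOn (fun C => (w C, q C)) (fun C hC => ?_) ?_
        · simpa using ⟨hF (hw C hC), hq C hC⟩
        · intro C hC D hD h
          simp only [Prod.mk.injEq] at h
          refine eq_of_mem_componentsIn (hT hC) (hT hD) (hzC C hC) ?_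
          rw [← hz C hC, h.1, h.2, hz D hD]
          exact hzC D hD
    _ = F.card * (SSBoundary S K).ncard := by
        rw [Finset.card_product, Set.ncard_eq_toFinset_card _ hfin]
    _ ≤ B * (SSBoundary S K).ncard := Nat.mul_le_mul_right _ hFcard

/-- **Theorem 5.6(1)** (uniformly bounded orders): if `K` is a dendrite with finite
self-similar boundary and the index diagram has no cyclic vertex of outdegree ≥ 2,
then the orders of points of `K` are uniformly bounded. -/
theorem uniformly_bounded_orders
    {X : Type*} [MetricSpace X] [CompleteSpace X] {m : ℕ}
    (S : Fin m → X → X) (r : Fin m → NNReal) (hr : ∀ i, r i < 1)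
    (hlip : ∀ i, LipschitzWith (r i) (S i)) (hinj : ∀ i, Function.Injective (S i))
    (K : Set X) (hKne : K.Nonempty) (hKcp : IsCompact K) (hKeq : K = ⋃ i, S i '' K)
    (hdend : IsDendrite K) (hfin : (SSBoundary S K).Finite)
    (hcyc : ∀ p ∈ SSBoundary S K, (∃ w : List (Fin m), w ≠ [] ∧ SWord S w p = p) →
      {kq : Fin m × X | kq.2 ∈ SSBoundary S K ∧ S kq.1 kq.2 = p}.Subsingleton) :
    ∃ M : ℕ, ∀ x ∈ K, (ComponentsIn (K \ {x})).Finite ∧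
      Nat.card (ComponentsIn (K \ {x})) ≤ M := by
  have hm : 0 < m := by
    obtain ⟨x, hx⟩ := hKne
    rw [hKeq] at hx
    obtain ⟨i, -⟩ := Set.mem_iUnion.1 hx
    exact i.pos
  have hK : ∀ i, ∀ x ∈ K, S i x ∈ K := fun i x hx => by
    rw [hKeq]; exact Set.mem_iUnion.2 ⟨i, x, hx, rfl⟩
  obtain ⟨-, hconn, hloc, -⟩ := hdend
  have hρ : Finset.univ.sup r < 1 := (Finset.sup_lt_iff one_pos).2 fun i _ => hr i
  refine ⟨m * m ^ (SSBoundary S K).ncard * (SSBoundary S K).ncard, fun x hx => ?_⟩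
  have hT := card_le_of_subset_componentsIn hρ
    (fun i => (hlip i).weaken (Finset.le_sup (Finset.mem_univ i))) hinj hKcp hKeq hconn hfin hx
    (fun n => exists_cellWords_subset hinj hK hm hfin hcyc n x)
  have hcfin : (ComponentsIn (K \ {x})).Finite := by
    by_contra hinf
    obtain ⟨T, hsub, hcard⟩ := Set.Infinite.exists_subset_card_eq hinf
      (m * m ^ (SSBoundary S K).ncard * (SSBoundary S K).ncard + 1)
    have := hT T hsub
    omega
  refine ⟨hcfin, ?_⟩
  rw [Nat.card_coe_set_eq, Set.ncard_eq_toFinset_card _ hcfin]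
  exact hT _ (by simp)
end

section
/- Proposition 4.5 (homeomorphism from compatible refinement sequences): Let X and X̃ be metric spaces, and for each n ≥ 1 let (K_i^n)_{i ∈ J_n} and (K̃_i^n)_{i ∈ J_n} be SIP systems of continua in X and X̃ respectively, indexed by the same finite sets J_n, forming refinement sequences for K = ⋃_{i∈J_1} K_i^1 and K̃ = ⋃_{i∈J_1} K̃_i^1, with ⋃_{i∈J_n} K_i^n = K and ⋃_{i∈J_n} K̃_i^n = K̃ for all n. Assume: (ii) for all n and all i, j ∈ J_n, K_i^n ∩ K_j^n ≠ ∅ if and only if K̃_i^n ∩ K̃_j^n ≠ ∅; and (iii) for all n, all i ∈ J_n and j ∈ J_{n+1}, K_i^n ⊇ K_j^{n+1} if and only if K̃_i^n ⊇ K̃_j^{n+1}. Then there exists a homeomorphism f : K → K̃ such that f(K_i^n) = K̃_i^n for every n and every i ∈ J_n. -/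
/-- A SIP system of continua: a finite family of nonempty compact connected sets whose
pairwise intersections are at most singletons. -/
def SIPSystem {X : Type*} [TopologicalSpace X] {J : Type*} (C : J → Set X) : Prop :=
  (∀ i, (C i).Nonempty ∧ IsCompact (C i) ∧ IsConnected (C i)) ∧
    ∀ i j, i ≠ j → (C i ∩ C j).Subsingleton

/-- The system `L` is a refinement of the system `Kf`: every member of `L` lies in some
member of `Kf`, and for every `i` the union of the members of `L` contained in `Kf i`
is connected and contains every point of `Kf i` lying in some `Kf i'` with `i' ≠ i`. -/
def IsRefinement {X : Type*} [TopologicalSpace X] {J J' : Type*}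
    (Kf : J → Set X) (L : J' → Set X) : Prop :=
  (∀ j, ∃ i, L j ⊆ Kf i) ∧
    ∀ i, IsConnected (⋃ j ∈ {j | L j ⊆ Kf i}, L j) ∧
      (Kf i ∩ ⋃ (i') (_ : i' ≠ i), Kf i') ⊆ ⋃ j ∈ {j | L j ⊆ Kf i}, L j

/-- A refinement sequence of SIP systems: each level refines the previous one, and
every nested sequence of members has a singleton intersection. -/
def RefinementSeq {X : Type*} [TopologicalSpace X] {J : ℕ → Type*}
    (Kf : (n : ℕ) → J n → Set X) : Prop :=
  (∀ n, IsRefinement (Kf n) (Kf (n + 1))) ∧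
    ∀ idx : (n : ℕ) → J n, (∀ n, Kf (n + 1) (idx (n + 1)) ⊆ Kf n (idx n)) →
      ∃ x, ⋂ n, Kf n (idx n) = {x}

open Set

/-- A form of Kőnig's lemma: if every point of level `n + 1` has a parent, then nonempty finite
levels admit an infinite branch. -/
theorem exists_branch_of_forall_exists_parent {J : ℕ → Type} [∀ n, Finite (J n)]
    (P : ∀ n, J n → Prop) (r : ∀ n, J n → J (n + 1) → Prop) (hne : ∀ n, ∃ i, P n i)
    (hparent : ∀ n j, P (n + 1) j → ∃ i, P n i ∧ r n i j) :
    ∃ s : ∀ n, J n, ∀ n, P n (s n) ∧ r n (s n) (s (n + 1)) := by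
  choose p hpP hpr using hparent
  have : ∀ n, Nonempty {i // P n i} := fun n => (hne n).elim fun i hi => ⟨⟨i, hi⟩⟩
  let parent (n : ℕ) (j : {j // P (n + 1) j}) : {i // P n i} := ⟨p n j.1 j.2, hpP n j.1 j.2⟩
  let proj {m n : ℕ} (h : m ≤ n) : {j // P n j} → {i // P m i} :=
    Nat.leRec (motive := fun n _ => {j // P n j} → {i // P m i}) id
      (fun n _ f => f ∘ parent n) h
  have proj_refl (m : ℕ) : proj (le_refl m) = id := Nat.leRec_self _ _
  have proj_succ {m n : ℕ} (h : m ≤ n) : proj (Nat.le_succ_of_le h) = proj h ∘ parent n :=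
    Nat.leRec_succ _ _ h
  have proj_trans {l m : ℕ} (hlm : l ≤ m) {n : ℕ} (hmn : m ≤ n) :
      proj hlm ∘ proj hmn = proj (hlm.trans hmn) := by
    induction n, hmn using Nat.le_induction with
    | base => rw [proj_refl, Function.comp_id]
    | succ n hmn ih =>
      rw [proj_succ hmn, ← Function.comp_assoc, ih]
      exact (proj_succ (hlm.trans hmn)).symm
  obtain ⟨f, hf⟩ := exists_seq_forall_proj_of_forall_finite (α := fun n => {i // P n i})
    (fun h => proj h) (fun _ a => congrFun (proj_refl _) a)
    (fun _ _ _ hij hjk a => congrFun (proj_trans hij hjk) a) (fun _ _ => Set.toFinite _)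
  refine ⟨fun n => (f n).1, fun n => ⟨(f n).2, ?_⟩⟩
  have hn : parent n (f (n + 1)) = f n := by
    have h := hf (Nat.le_succ n)
    have h' := congrFun (proj_succ (le_refl n)) (f (n + 1))
    rw [proj_refl] at h'
    exact h'.symm.trans h
  have h := hpr n (f (n + 1)).1 (f (n + 1)).2
  rwa [show p n (f (n + 1)).1 (f (n + 1)).2 = (f n).1 from congrArg Subtype.val hn] at h

/-- If every point has a parent and a child, then every point lies on an infinite branch. -/
theorem exists_branch_through {J : ℕ → Type} (P : ∀ n, J n → Prop)
    (r : ∀ n, J n → J (n + 1) → Prop)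
    (hparent : ∀ n j, P (n + 1) j → ∃ i, P n i ∧ r n i j)
    (hchild : ∀ n i, P n i → ∃ j, P (n + 1) j ∧ r n i j) (n : ℕ) (i : J n) (hi : P n i) :
    ∃ s : ∀ n, J n, s n = i ∧ ∀ n, P n (s n) ∧ r n (s n) (s (n + 1)) := by
  induction n generalizing J with
  | zero =>
    choose c hcP hcr using hchild
    let t : ∀ n, {i // P n i} := fun n => Nat.rec ⟨i, hi⟩ (fun n a => ⟨c n a.1 a.2, hcP n a.1 a.2⟩) n
    exact ⟨fun n => (t n).1, rfl, fun n => ⟨(t n).2, hcr n (t n).1 (t n).2⟩⟩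
  | succ n ih =>
    obtain ⟨s, hsi, hs⟩ := ih (J := fun n => J (n + 1)) (fun n => P (n + 1))
      (fun n => r (n + 1)) (fun n => hparent (n + 1)) (fun n => hchild (n + 1)) i hi
    obtain ⟨a, haP, har⟩ := hparent 0 (s 0) (hs 0).1
    refine ⟨fun m => Nat.rec a (fun m _ => s m) m, hsi, fun m => ?_⟩
    cases m with
    | zero => exact ⟨haP, har⟩
    | succ m => exact hs m

/-- A compact relation that is functional in both directions is the graph of a homeomorphism
between its two projections. -/
theorem IsCompact.exists_homeomorph_of_injOn {X Y : Type*} [TopologicalSpace X] [T2Space X]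
    [TopologicalSpace Y] [T2Space Y] {R : Set (X × Y)} (hR : IsCompact R)
    (hfst : InjOn Prod.fst R) (hsnd : InjOn Prod.snd R) :
    ∃ f : (Prod.fst '' R : Set X) ≃ₜ (Prod.snd '' R : Set Y), ∀ x, (x.1, (f x).1) ∈ R := by
  have : CompactSpace R := isCompact_iff_compactSpace.mp hR
  let e₁ : R ≃ₜ (Prod.fst '' R : Set X) :=
    Continuous.homeoOfEquivCompactToT2 (f := Equiv.Set.imageOfInjOn Prod.fst R hfst)
      ((continuous_fst.comp continuous_subtype_val).subtype_mk _)
  let e₂ : R ≃ₜ (Prod.snd '' R : Set Y) :=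
    Continuous.homeoOfEquivCompactToT2 (f := Equiv.Set.imageOfInjOn Prod.snd R hsnd)
      ((continuous_snd.comp continuous_subtype_val).subtype_mk _)
  refine ⟨e₁.symm.trans e₂, fun x => ?_⟩
  obtain ⟨p, rfl⟩ := e₁.surjective x
  rw [Homeomorph.trans_apply, Homeomorph.symm_apply_apply]
  exact p.2

/-- A member of a system of sets is covered by the members of a refinement which it contains,
provided that both systems have the same union. -/
theorem IsRefinement.exists_mem_subset {X J J' : Type*} [TopologicalSpace X] {Kf : J → Set X}
    {L : J' → Set X} (h : IsRefinement Kf L) (hcov : ⋃ i, Kf i = ⋃ j, L j) {i : J} {x : X}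
    (hx : x ∈ Kf i) : ∃ j, x ∈ L j ∧ L j ⊆ Kf i := by
  obtain ⟨j, hj⟩ := mem_iUnion.mp (hcov ▸ mem_iUnion_of_mem i hx)
  obtain ⟨i', hi'⟩ := h.1 j
  by_cases hii' : i' = i
  · exact ⟨j, hj, hii' ▸ hi'⟩
  · have hmem := (h.2 i).2 ⟨hx, mem_iUnion₂.mpr ⟨i', hii', hi' hj⟩⟩
    obtain ⟨k, hk, hxk⟩ := mem_iUnion₂.mp hmem
    exact ⟨k, hxk, hk⟩

section CommonRel

variable {X X' : Type*} {J : ℕ → Type}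

/-- Two points are related if at every level they lie in members with a common index. -/
def commonRel (Kf : (n : ℕ) → J n → Set X) (Kf' : (n : ℕ) → J n → Set X') : Set (X × X') :=
  ⋂ n, ⋃ i, Kf n i ×ˢ Kf' n i

theorem mem_commonRel {Kf : (n : ℕ) → J n → Set X} {Kf' : (n : ℕ) → J n → Set X'}
    {p : X × X'} : p ∈ commonRel Kf Kf' ↔ ∀ n, ∃ i, p.1 ∈ Kf n i ∧ p.2 ∈ Kf' n i := by
  simp [commonRel]

theorem swap_mem_commonRel {Kf : (n : ℕ) → J n → Set X} {Kf' : (n : ℕ) → J n → Set X'}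
    {p : X × X'} : p.swap ∈ commonRel Kf' Kf ↔ p ∈ commonRel Kf Kf' := by
  simp only [mem_commonRel, Prod.fst_swap, Prod.snd_swap, and_comm]

variable [MetricSpace X]

theorem isCompact_commonRel [MetricSpace X'] [∀ n, Finite (J n)]
    {Kf : (n : ℕ) → J n → Set X} {Kf' : (n : ℕ) → J n → Set X'}
    (hSIP : ∀ n, SIPSystem (Kf n)) (hSIP' : ∀ n, SIPSystem (Kf' n)) :
    IsCompact (commonRel Kf Kf') := by
  have h (n : ℕ) : IsCompact (⋃ i, Kf n i ×ˢ Kf' n i) :=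
    isCompact_iUnion fun i => ((hSIP n).1 i).2.1.prod ((hSIP' n).1 i).2.1
  exact (h 0).of_isClosed_subset (isClosed_iInter fun n => (h n).isClosed) (iInter_subset _ 0)

theorem exists_nested_of_mem_commonRel [∀ n, Finite (J n)]
    {Kf : (n : ℕ) → J n → Set X} {Kf' : (n : ℕ) → J n → Set X'}
    (hrseq : RefinementSeq Kf)
    (hiii : ∀ n (i : J n) (j : J (n + 1)),
      Kf (n + 1) j ⊆ Kf n i ↔ Kf' (n + 1) j ⊆ Kf' n i)
    {p : X × X'} (hp : p ∈ commonRel Kf Kf') :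
    ∃ s : (n : ℕ) → J n, ∀ n, (p.1 ∈ Kf n (s n) ∧ p.2 ∈ Kf' n (s n)) ∧
      Kf' (n + 1) (s (n + 1)) ⊆ Kf' n (s n) := by
  refine exists_branch_of_forall_exists_parent (fun n i => p.1 ∈ Kf n i ∧ p.2 ∈ Kf' n i)
    (fun n i j => Kf' (n + 1) j ⊆ Kf' n i) (mem_commonRel.mp hp) fun n j hj => ?_
  obtain ⟨i, hi⟩ := (hrseq.1 n).1 j
  exact ⟨i, ⟨hi hj.1, (hiii n i j).mp hi hj.2⟩, (hiii n i j).mp hi⟩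

theorem injOn_fst_commonRel [MetricSpace X'] [∀ n, Finite (J n)]
    {Kf : (n : ℕ) → J n → Set X} {Kf' : (n : ℕ) → J n → Set X'}
    (hSIP' : ∀ n, SIPSystem (Kf' n))
    (hrseq : RefinementSeq Kf) (hrseq' : RefinementSeq Kf')
    (hii : ∀ n (i j : J n), (Kf n i ∩ Kf n j).Nonempty ↔ (Kf' n i ∩ Kf' n j).Nonempty)
    (hiii : ∀ n (i : J n) (j : J (n + 1)),
      Kf (n + 1) j ⊆ Kf n i ↔ Kf' (n + 1) j ⊆ Kf' n i) :
    InjOn Prod.fst (commonRel Kf Kf') := by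
  intro p hp q hq hpq
  obtain ⟨s, hs⟩ := exists_nested_of_mem_commonRel hrseq hiii hp
  obtain ⟨t, ht⟩ := exists_nested_of_mem_commonRel hrseq hiii hq
  have hcompact (n : ℕ) : IsCompact (Kf' n (s n) ∩ Kf' n (t n)) :=
    ((hSIP' n).1 _).2.1.inter ((hSIP' n).1 _).2.1
  obtain ⟨z, hz⟩ := IsCompact.nonempty_iInter_of_sequence_nonempty_isCompact_isClosed
    (fun n => Kf' n (s n) ∩ Kf' n (t n))
    (fun n => inter_subset_inter (hs n).2 (ht n).2)
    (fun n => (hii n _ _).mp ⟨p.1, (hs n).1.1, hpq ▸ (ht n).1.1⟩)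
    (hcompact 0) (fun n => (hcompact n).isClosed)
  rw [mem_iInter] at hz
  have eq_of_mem {u : (n : ℕ) → J n} (hu : ∀ n, Kf' (n + 1) (u (n + 1)) ⊆ Kf' n (u n)) {a b : X'}
      (ha : ∀ n, a ∈ Kf' n (u n)) (hb : ∀ n, b ∈ Kf' n (u n)) : a = b := by
    obtain ⟨w, hw⟩ := hrseq'.2 u hu
    exact subsingleton_singleton (hw ▸ mem_iInter.mpr ha) (hw ▸ mem_iInter.mpr hb)
  refine Prod.ext hpq ?_
  exact (eq_of_mem (fun n => (hs n).2) (fun n => (hs n).1.2) fun n => (hz n).1).trans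
    (eq_of_mem (fun n => (ht n).2) (fun n => (hz n).2) fun n => (ht n).1.2)

variable [MetricSpace X']

theorem exists_mem_commonRel_of_mem
    {Kf : (n : ℕ) → J n → Set X} {Kf' : (n : ℕ) → J n → Set X'} {K : Set X}
    (hrseq : RefinementSeq Kf) (hrseq' : RefinementSeq Kf') (hcov : ∀ n, ⋃ i, Kf n i = K)
    (hiii : ∀ n (i : J n) (j : J (n + 1)),
      Kf (n + 1) j ⊆ Kf n i ↔ Kf' (n + 1) j ⊆ Kf' n i)
    {n : ℕ} {i : J n} {x : X} (hx : x ∈ Kf n i) :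
    ∃ y ∈ Kf' n i, (x, y) ∈ commonRel Kf Kf' := by
  obtain ⟨s, hsi, hs⟩ := exists_branch_through (fun n i => x ∈ Kf n i)
    (fun n i j => Kf (n + 1) j ⊆ Kf n i)
    (fun n j hj => ((hrseq.1 n).1 j).imp fun i hi => ⟨hi hj, hi⟩)
    (fun n i hi => (hrseq.1 n).exists_mem_subset ((hcov n).trans (hcov (n + 1)).symm) hi) n i hx
  obtain ⟨y, hy⟩ := hrseq'.2 s fun n => (hiii n _ _).mp (hs n).2
  have hys : ∀ n, y ∈ Kf' n (s n) := mem_iInter.mp (hy ▸ mem_singleton y)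
  exact ⟨y, hsi ▸ hys n, mem_commonRel.mpr fun m => ⟨s m, (hs m).1, hys m⟩⟩

theorem image_fst_commonRel
    {Kf : (n : ℕ) → J n → Set X} {Kf' : (n : ℕ) → J n → Set X'} {K : Set X}
    (hrseq : RefinementSeq Kf) (hrseq' : RefinementSeq Kf') (hcov : ∀ n, ⋃ i, Kf n i = K)
    (hiii : ∀ n (i : J n) (j : J (n + 1)),
      Kf (n + 1) j ⊆ Kf n i ↔ Kf' (n + 1) j ⊆ Kf' n i) :
    Prod.fst '' commonRel Kf Kf' = K := by
  ext x
  rw [← hcov 0, mem_iUnion]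
  constructor
  · rintro ⟨p, hp, rfl⟩
    exact (mem_commonRel.mp hp 0).imp fun _ h => h.1
  · rintro ⟨i, hi⟩
    obtain ⟨y, -, hy⟩ := exists_mem_commonRel_of_mem hrseq hrseq' hcov hiii hi
    exact ⟨(x, y), hy, rfl⟩

end CommonRel

/-- **Proposition 4.5** (homeomorphism from compatible refinement sequences). -/
theorem homeomorphism_of_compatible_refinement_sequences
    {X X' : Type*} [MetricSpace X] [MetricSpace X']
    (J : ℕ → Type) [∀ n, Finite (J n)]
    (Kf : (n : ℕ) → J n → Set X) (Kf' : (n : ℕ) → J n → Set X')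
    (K : Set X) (K' : Set X')
    (hSIP : ∀ n, SIPSystem (Kf n)) (hSIP' : ∀ n, SIPSystem (Kf' n))
    (hrseq : RefinementSeq Kf) (hrseq' : RefinementSeq Kf')
    (hcov : ∀ n, ⋃ i, Kf n i = K) (hcov' : ∀ n, ⋃ i, Kf' n i = K')
    (hii : ∀ n (i j : J n), (Kf n i ∩ Kf n j).Nonempty ↔ (Kf' n i ∩ Kf' n j).Nonempty)
    (hiii : ∀ n (i : J n) (j : J (n + 1)),
      Kf (n + 1) j ⊆ Kf n i ↔ Kf' (n + 1) j ⊆ Kf' n i) :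
    ∃ f : K ≃ₜ K', ∀ n (i : J n),
      Subtype.val '' (f '' (Subtype.val ⁻¹' Kf n i)) = Kf' n i := by
  have hiiiS := fun n i j => (hiii n i j).symm
  have hfst : InjOn Prod.fst (commonRel Kf Kf') :=
    injOn_fst_commonRel hSIP' hrseq hrseq' hii hiii
  have hsnd : InjOn Prod.snd (commonRel Kf Kf') := fun p hp q hq hpq =>
    Prod.swap_injective <| injOn_fst_commonRel hSIP hrseq' hrseq
      (fun n i j => (hii n i j).symm) hiiiS (swap_mem_commonRel.mpr hp)
      (swap_mem_commonRel.mpr hq) hpq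
  have hK : Prod.fst '' commonRel Kf Kf' = K := image_fst_commonRel hrseq hrseq' hcov hiii
  have hK' : Prod.snd '' commonRel Kf Kf' = K' := by
    rw [← image_fst_commonRel hrseq' hrseq hcov' hiiiS]
    ext y
    constructor
    · rintro ⟨p, hp, rfl⟩
      exact ⟨p.swap, swap_mem_commonRel.mpr hp, rfl⟩
    · rintro ⟨p, hp, rfl⟩
      exact ⟨p.swap, swap_mem_commonRel.mpr hp, rfl⟩
  obtain ⟨f, hf⟩ := (isCompact_commonRel hSIP hSIP').exists_homeomorph_of_injOn hfst hsnd
  subst hK hK'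
  refine ⟨f, fun n i => Subset.antisymm ?_ fun y hy => ?_⟩
  · rintro _ ⟨_, ⟨x, hx, rfl⟩, rfl⟩
    obtain ⟨y, hy, hxy⟩ := exists_mem_commonRel_of_mem hrseq hrseq' hcov hiii hx
    rwa [show (f x : X') = y from congrArg Prod.snd (hfst (hf x) hxy rfl)]
  · obtain ⟨x, hx, hyx⟩ := exists_mem_commonRel_of_mem hrseq' hrseq hcov' hiiiS hy
    have hxy : (x, y) ∈ commonRel Kf Kf' := swap_mem_commonRel.mp hyx
    exact ⟨_, ⟨⟨x, (x, y), hxy, rfl⟩, hx, rfl⟩, congrArg Prod.snd (hfst (hf _) hxy rfl)⟩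
end

section
/- Proposition 5.3(1): Let G be a finite directed multigraph and p a vertex. Suppose that any two circuits of G, each of whose vertex sets is reachable from p, are either rotations of one another or mutually unreachable (no vertex of one reaches any vertex of the other). Then the set of infinite walks starting at p is finite and every infinite walk from p is eventually periodic. Moreover, if this hypothesis holds for every vertex p of G, then there is a constant M such that every vertex has at most M infinite walks starting from it. -/
/-- There is an edge from `u` to `v`. -/
def Step {V E : Type} (src tgt : E → V) (u v : V) : Prop :=
  ∃ e : E, src e = u ∧ tgt e = v

/-- `u` reaches `v`: `u = v` or there is a finite walk from `u` to `v`. -/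
def Reaches {V E : Type} (src tgt : E → V) : V → V → Prop :=
  Relation.ReflTransGen (Step src tgt)

/-- An infinite walk starting at `p`. -/
def IsInfWalk {V E : Type} (src tgt : E → V) (p : V) (f : ℕ → E) : Prop :=
  src (f 0) = p ∧ ∀ n : ℕ, tgt (f n) = src (f (n + 1))

/-- An eventually periodic sequence of edges. -/
def EventuallyPeriodic {E : Type} (f : ℕ → E) : Prop :=
  ∃ N T : ℕ, 1 ≤ T ∧ ∀ n : ℕ, N ≤ n → f (n + T) = f n

/-- A circuit: a nonempty closed finite walk whose vertices are pairwise distinct. -/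
structure Circuit {V E : Type} (src tgt : E → V) where
  edges : List E
  ne : edges ≠ []
  chain : edges.Chain' fun e f => tgt e = src f
  closed : tgt (edges.getLast ne) = src (edges.head ne)
  nodup : (edges.map src).Nodup

/-- The list of vertices of a circuit. -/
def Circuit.verts {V E : Type} {src tgt : E → V} (c : Circuit src tgt) : List V :=
  c.edges.map src

section Walks

variable {V E : Type} {src tgt : E → V}

/-- `IsEdgePath src tgt a l b`: the list of edges `l` is a (possibly empty) walk from `a` to `b`. -/
def IsEdgePath (src tgt : E → V) : V → List E → V → Prop
  | a, [], b => a = b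
  | a, e :: l, b => src e = a ∧ IsEdgePath src tgt (tgt e) l b

/-- An edge is recurrent if its target reaches its source. -/
def IsRecurrentEdge (src tgt : E → V) (e : E) : Prop :=
  Reaches src tgt (tgt e) (src e)

/-- Any two circuits reachable from `p` are rotations of one another or mutually unreachable. -/
def IndependentCircuitsFrom (src tgt : E → V) (p : V) : Prop :=
  ∀ c₁ c₂ : Circuit src tgt,
    (∃ v ∈ c₁.verts, Reaches src tgt p v) → (∃ v ∈ c₂.verts, Reaches src tgt p v) →
    (∃ n : ℕ, c₁.edges = c₂.edges.rotate n) ∨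
      ∀ u ∈ c₁.verts, ∀ v ∈ c₂.verts, ¬ Reaches src tgt u v ∧ ¬ Reaches src tgt v u

theorem reaches_src_tgt (e : E) : Reaches src tgt (src e) (tgt e) :=
  Relation.ReflTransGen.single ⟨e, rfl, rfl⟩

theorem Reaches.trans {a b c : V} (hab : Reaches src tgt a b) (hbc : Reaches src tgt b c) :
    Reaches src tgt a c :=
  Relation.ReflTransGen.trans hab hbc

namespace IsEdgePath

theorem reaches {l : List E} {a b : V} (h : IsEdgePath src tgt a l b) : Reaches src tgt a b := by
  induction l generalizing a with
  | nil => cases h; exact Relation.ReflTransGen.refl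
  | cons e l ih =>
    obtain ⟨rfl, h⟩ := h
    exact (reaches_src_tgt e).trans (ih h)

theorem exists_suffix {l : List E} {a b v : V} (h : IsEdgePath src tgt a l b)
    (hv : v ∈ l.map src) : ∃ l', l' <:+ l ∧ IsEdgePath src tgt v l' b := by
  induction l generalizing a with
  | nil => simp at hv
  | cons e l ih =>
    rcases List.mem_cons.1 hv with rfl | hv
    · exact ⟨e :: l, List.suffix_refl _, rfl, h.2⟩
    · obtain ⟨l', hl', hp⟩ := ih h.2 hv
      exact ⟨l', hl'.trans (List.suffix_cons e l), hp⟩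

theorem isChain_cons {l : List E} {e : E} {b : V} (h : IsEdgePath src tgt (tgt e) l b) :
    (e :: l).IsChain fun e f => tgt e = src f := by
  induction l generalizing e with
  | nil => simp
  | cons f l ih => exact List.isChain_cons_cons.2 ⟨h.1.symm, ih h.2⟩

theorem tgt_getLast_cons {l : List E} {e : E} {b : V} (h : IsEdgePath src tgt (tgt e) l b) :
    tgt ((e :: l).getLast (List.cons_ne_nil e l)) = b := by
  induction l generalizing e with
  | nil => exact h
  | cons f l ih =>
    rw [List.getLast_cons_cons]
    exact ih h.2

end IsEdgePath

theorem Reaches.exists_simple_edgePath {a b : V} (h : Reaches src tgt a b) :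
    ∃ l, IsEdgePath src tgt a l b ∧ (l.map src).Nodup ∧ b ∉ l.map src := by
  induction h using Relation.ReflTransGen.head_induction_on with
  | refl => exact ⟨[], rfl, by simp, by simp⟩
  | head hstep _ ih =>
    obtain ⟨e, rfl, rfl⟩ := hstep
    obtain ⟨l, hl, hnd, hb⟩ := ih
    by_cases hab : src e = b
    · exact ⟨[], hab, by simp, by simp⟩
    by_cases hmem : src e ∈ l.map src
    · obtain ⟨l', hl', hp⟩ := hl.exists_suffix hmem
      have hs := hl'.map src
      exact ⟨l', hp, hnd.sublist hs.sublist, fun hb' => hb (hs.subset hb')⟩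
    · refine ⟨e :: l, ⟨rfl, hl⟩, List.nodup_cons.2 ⟨hmem, hnd⟩, fun hb' => ?_⟩
      rcases List.mem_cons.1 hb' with h' | h'
      · exact hab h'.symm
      · exact hb h'

theorem IsRecurrentEdge.exists_circuit {e : E} (he : IsRecurrentEdge src tgt e) :
    ∃ c : Circuit src tgt, e ∈ c.edges ∧ ∀ x ∈ c.edges, Reaches src tgt (src x) (src e) := by
  obtain ⟨l, hl, hnd, hb⟩ := Reaches.exists_simple_edgePath he
  refine ⟨⟨e :: l, List.cons_ne_nil e l, hl.isChain_cons, hl.tgt_getLast_cons,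
    List.nodup_cons.2 ⟨hb, hnd⟩⟩, List.mem_cons_self, fun x hx => ?_⟩
  rcases List.mem_cons.1 hx with rfl | hx
  · exact Relation.ReflTransGen.refl
  · obtain ⟨l', -, hp⟩ := hl.exists_suffix (List.mem_map_of_mem hx)
    exact hp.reaches

namespace IndependentCircuitsFrom

variable {p : V}

theorem exists_common_circuit (hp : IndependentCircuitsFrom src tgt p) {e e' : E}
    (hpe : Reaches src tgt p (src e))
    (hee' : Reaches src tgt (src e) (src e')) (he : IsRecurrentEdge src tgt e)
    (he' : IsRecurrentEdge src tgt e') :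
    ∃ c : Circuit src tgt, e ∈ c.edges ∧ e' ∈ c.edges ∧
      ∀ x ∈ c.edges, Reaches src tgt (src x) (src e) := by
  obtain ⟨c, hc, hr⟩ := he.exists_circuit
  obtain ⟨c', hc', -⟩ := he'.exists_circuit
  have hv : src e ∈ c.verts := List.mem_map_of_mem hc
  have hv' : src e' ∈ c'.verts := List.mem_map_of_mem hc'
  rcases hp c c' ⟨_, hv, hpe⟩ ⟨_, hv', hpe.trans hee'⟩ with ⟨n, hn⟩ | h
  · exact ⟨c, hc, by rwa [hn, List.mem_rotate], hr⟩
  · exact absurd hee' (h _ hv _ hv').1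

theorem recurrentEdge_unique (hp : IndependentCircuitsFrom src tgt p) {e e' : E}
    (hpe : Reaches src tgt p (src e)) (h : src e = src e')
    (he : IsRecurrentEdge src tgt e) (he' : IsRecurrentEdge src tgt e') : e = e' := by
  obtain ⟨c, hc, hc', -⟩ :=
    hp.exists_common_circuit hpe (h ▸ Relation.ReflTransGen.refl) he he'
  exact List.inj_on_of_nodup_map c.nodup hc hc' h

theorem reaches_src_of_recurrentEdge (hp : IndependentCircuitsFrom src tgt p) {e e' : E}
    (hpe : Reaches src tgt p (src e))
    (hee' : Reaches src tgt (src e) (src e')) (he : IsRecurrentEdge src tgt e)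
    (he' : IsRecurrentEdge src tgt e') : Reaches src tgt (src e') (src e) := by
  obtain ⟨c, -, hc', hr⟩ := hp.exists_common_circuit hpe hee' he he'
  exact hr _ hc'

end IndependentCircuitsFrom

namespace IsInfWalk

variable {p : V} {f g : ℕ → E}

theorem reaches_src_src (hf : IsInfWalk src tgt p f) {m n : ℕ} (hmn : m ≤ n) :
    Reaches src tgt (src (f m)) (src (f n)) := by
  induction n, hmn using Nat.le_induction with
  | base => exact Relation.ReflTransGen.refl
  | succ n _ ih => exact ih.trans (hf.2 n ▸ reaches_src_tgt (f n))

theorem reaches_src (hf : IsInfWalk src tgt p f) (n : ℕ) : Reaches src tgt p (src (f n)) :=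
  hf.1 ▸ hf.reaches_src_src n.zero_le

theorem reaches_tgt_src (hf : IsInfWalk src tgt p f) {m n : ℕ} (hmn : m < n) :
    Reaches src tgt (tgt (f m)) (src (f n)) :=
  hf.2 m ▸ hf.reaches_src_src hmn

theorem exists_recurrentEdge [Finite E] (hf : IsInfWalk src tgt p f) (m : ℕ) :
    ∃ i, m ≤ i ∧ i ≤ m + Nat.card E ∧ IsRecurrentEdge src tgt (f i) := by
  have hni : ¬ Function.Injective fun i : Fin (Nat.card E + 1) => f (m + i) := fun h => by
    simpa using Nat.card_le_card_of_injective _ h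
  obtain ⟨i, j, hij, hne⟩ := Function.not_injective_iff.1 hni
  wlog hlt : i < j generalizing i j
  · exact this j i hij.symm hne.symm (lt_of_le_of_ne (not_lt.1 hlt) hne.symm)
  refine ⟨m + i, by omega, by omega, ?_⟩
  have h := hf.reaches_tgt_src (Nat.add_lt_add_left (Fin.lt_def.1 hlt) m)
  rwa [← show f (m + i) = f (m + j) from hij] at h

theorem isRecurrentEdge [Finite E] (hp : IndependentCircuitsFrom src tgt p)
    (hf : IsInfWalk src tgt p f) {n : ℕ} (hn : Nat.card E ≤ n) :
    IsRecurrentEdge src tgt (f n) := by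
  obtain ⟨i, -, hi, hri⟩ := hf.exists_recurrentEdge 0
  obtain ⟨k, hk, -, hrk⟩ := hf.exists_recurrentEdge (n + 1)
  exact (hf.reaches_tgt_src hk).trans
    ((hp.reaches_src_of_recurrentEdge (hf.reaches_src i) (hf.reaches_src_src (by omega))
      hri hrk).trans (hf.reaches_src_src (by omega)))

theorem next_eq [Finite E] (hp : IndependentCircuitsFrom src tgt p)
    (hf : IsInfWalk src tgt p f) (hg : IsInfWalk src tgt p g) {m n : ℕ}
    (hm : Nat.card E ≤ m) (hn : Nat.card E ≤ n) (h : f m = g n) : f (m + 1) = g (n + 1) :=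
  hp.recurrentEdge_unique (hf.reaches_src _) (by rw [← hf.2, ← hg.2, h])
    (hf.isRecurrentEdge hp (by omega)) (hg.isRecurrentEdge hp (by omega))

theorem eventuallyPeriodic [Finite E] (hp : IndependentCircuitsFrom src tgt p)
    (hf : IsInfWalk src tgt p f) : EventuallyPeriodic f := by
  obtain ⟨i, j, hne, hij⟩ := Finite.exists_ne_map_eq_of_infinite fun i => f (Nat.card E + i)
  wlog hlt : i < j generalizing i j
  · exact this j i hne.symm hij.symm (by omega)
  refine ⟨Nat.card E + i, j - i, by omega, fun n hn => ?_⟩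
  induction n, hn using Nat.le_induction with
  | base => simpa [show Nat.card E + i + (j - i) = Nat.card E + j by omega] using hij.symm
  | succ n hn ih =>
    rw [Nat.add_right_comm]
    exact hf.next_eq hp hf (by omega) (by omega) ih

theorem finite_setOf [Finite E] (hp : IndependentCircuitsFrom src tgt p) :
    {f : ℕ → E | IsInfWalk src tgt p f}.Finite := by
  refine Set.Finite.of_finite_image
    (f := fun (f : ℕ → E) (i : Fin (Nat.card E + 1)) => f i) (Set.toFinite _) ?_
  intro f hf g hg hfg
  have hle : ∀ n ≤ Nat.card E, f n = g n := fun n hn =>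
    congrFun hfg ⟨n, Nat.lt_succ_of_le hn⟩
  funext n
  rcases le_total n (Nat.card E) with hn | hn
  · exact hle n hn
  · induction n, hn using Nat.le_induction with
    | base => exact hle _ le_rfl
    | succ n hn ih => exact hf.next_eq hp hg hn hn ih

end IsInfWalk

end Walks

/-- **Proposition 5.3(1)**: if all circuits reachable from `p` are pairwise rotations of
one another or mutually unreachable, then there are finitely many infinite walks from
`p`, all eventually periodic; and if this holds at every vertex, the number of infinite
walks starting at any vertex is uniformly bounded. -/
theorem finitely_many_preperiodic_walks_of_independent_circuits
    {V E : Type} [Finite V] [Finite E] (src tgt : E → V) (p : V)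
    (hp : ∀ c₁ c₂ : Circuit src tgt,
      (∃ v ∈ c₁.verts, Reaches src tgt p v) → (∃ v ∈ c₂.verts, Reaches src tgt p v) →
      (∃ n : ℕ, c₁.edges = c₂.edges.rotate n) ∨
        ∀ u ∈ c₁.verts, ∀ v ∈ c₂.verts,
          ¬ Reaches src tgt u v ∧ ¬ Reaches src tgt v u) :
    ({f : ℕ → E | IsInfWalk src tgt p f}.Finite ∧
      ∀ f : ℕ → E, IsInfWalk src tgt p f → EventuallyPeriodic f) ∧
    ((∀ q : V, ∀ c₁ c₂ : Circuit src tgt,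
        (∃ v ∈ c₁.verts, Reaches src tgt q v) → (∃ v ∈ c₂.verts, Reaches src tgt q v) →
        (∃ n : ℕ, c₁.edges = c₂.edges.rotate n) ∨
          ∀ u ∈ c₁.verts, ∀ v ∈ c₂.verts,
            ¬ Reaches src tgt u v ∧ ¬ Reaches src tgt v u) →
      ∃ M : ℕ, ∀ q : V, {f : ℕ → E | IsInfWalk src tgt q f}.Finite ∧
        Nat.card {f : ℕ → E | IsInfWalk src tgt q f} ≤ M) := by
  refine ⟨⟨IsInfWalk.finite_setOf hp, fun f hf => hf.eventuallyPeriodic hp⟩, fun h => ?_⟩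
  obtain ⟨M, hM⟩ :=
    (Set.finite_range fun q => Nat.card {f : ℕ → E | IsInfWalk src tgt q f}).bddAbove
  exact ⟨M, fun q => ⟨IsInfWalk.finite_setOf (h q), hM ⟨q, rfl⟩⟩⟩
end

section
/- Proposition 5.3(2): Let G be a finite directed multigraph and p a vertex. Suppose there are circuits c₁ and c₂ of G and vertices a on c₁ and b on c₂ such that p reaches a, some vertex of c₁ reaches b, and b does not reach any vertex of c₁. Then the set of infinite walks starting at p is infinite. -/
/-- Following a circuit forever from one of its vertices gives an infinite walk that visits every
vertex of the circuit at a positive time. -/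
theorem Circuit.exists_isInfWalk {V E : Type} {src tgt : E → V} (c : Circuit src tgt) {v : V}
    (hv : v ∈ c.verts) :
    ∃ f : ℕ → E, IsInfWalk src tgt v f ∧ ∀ w ∈ c.verts, ∃ k, 0 < k ∧ src (f k) = w := by
  have hpos : 0 < c.edges.length := List.length_pos_iff.2 c.ne
  have hnext (j : ℕ) (hj : j < c.edges.length) :
      tgt c.edges[j] = src (c.edges[(j + 1) % c.edges.length]'(Nat.mod_lt _ hpos)) := by
    rcases Nat.lt_or_ge (j + 1) c.edges.length with h | h
    · simp only [Nat.mod_eq_of_lt h]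
      exact List.isChain_iff_getElem.1 c.chain j h
    · obtain rfl : j = c.edges.length - 1 := by omega
      have hclosed := c.closed
      rw [List.getLast_eq_getElem, List.head_eq_getElem] at hclosed
      simp only [Nat.sub_add_cancel hpos, Nat.mod_self]
      exact hclosed
  obtain ⟨e, he, rfl⟩ := List.mem_map.1 hv
  obtain ⟨i, hi, rfl⟩ := List.mem_iff_getElem.1 he
  refine ⟨fun n => c.edges[(i + n) % c.edges.length]'(Nat.mod_lt _ hpos), ⟨?_, fun n => ?_⟩,
    fun w hw => ?_⟩
  · simp [Nat.mod_eq_of_lt hi]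
  · have hmod : (i + (n + 1)) % c.edges.length =
        ((i + n) % c.edges.length + 1) % c.edges.length := by
      rw [← add_assoc, Nat.mod_add_mod]
    simp only [hmod]
    exact hnext _ (Nat.mod_lt _ hpos)
  · obtain ⟨e, he, rfl⟩ := List.mem_map.1 hw
    obtain ⟨j, hj, rfl⟩ := List.mem_iff_getElem.1 he
    have hmod : (i + (c.edges.length - i + j)) % c.edges.length = j := by
      rw [← add_assoc, Nat.add_sub_cancel' hi.le, Nat.add_mod_left, Nat.mod_eq_of_lt hj]
    exact ⟨c.edges.length - i + j, by omega, by simp only [hmod]⟩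

theorem IsInfWalk.step {V E : Type} {src tgt : E → V} {p : V} {f : ℕ → E}
    (hf : IsInfWalk src tgt p f) (n : ℕ) : Step src tgt (src (f n)) (src (f (n + 1))) :=
  ⟨f n, rfl, hf.2 n⟩

theorem IsInfWalk.reaches {V E : Type} {src tgt : E → V} {p : V} {f : ℕ → E}
    (hf : IsInfWalk src tgt p f) {m n : ℕ} (hmn : m ≤ n) :
    Reaches src tgt (src (f m)) (src (f n)) := by
  induction n, hmn using Nat.le_induction with
  | base => exact .refl
  | succ n _ ih => exact ih.tail (hf.step n)

/-- Any two vertices of a circuit are joined by a finite walk. -/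
theorem Circuit.transGen {V E : Type} {src tgt : E → V} (c : Circuit src tgt) {v w : V}
    (hv : v ∈ c.verts) (hw : w ∈ c.verts) : Relation.TransGen (Step src tgt) v w := by
  obtain ⟨f, hf, hvisit⟩ := c.exists_isInfWalk hv
  obtain ⟨k, hk, hfk⟩ := hvisit w hw
  have h := Relation.TransGen.head' (hf.step 0) (hf.reaches (Nat.succ_le_of_lt hk))
  rwa [hfk, hf.1] at h

/-- Prepend an edge to an infinite walk. -/
theorem IsInfWalk.cons {V E : Type} {src tgt : E → V} {e : E} {f : ℕ → E}
    (hf : IsInfWalk src tgt (tgt e) f) :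
    IsInfWalk src tgt (src e) (fun n => Nat.casesOn n e f) := by
  refine ⟨rfl, fun n => ?_⟩
  cases n with
  | zero => exact hf.1.symm
  | succ n => exact hf.2 n

/-- If `u` reaches `b`, every infinite walk from `b` extends to one from `u`. -/
theorem Reaches.exists_isInfWalk {V E : Type} {src tgt : E → V} {u b : V}
    (h : Reaches src tgt u b) {g : ℕ → E} (hg : IsInfWalk src tgt b g) :
    ∃ f, IsInfWalk src tgt u f ∧ ∃ m, src (f m) = b := by
  induction h using Relation.ReflTransGen.head_induction_on with
  | refl => exact ⟨g, hg, 0, hg.1⟩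
  | head hstep _ ih =>
    obtain ⟨e, rfl, rfl⟩ := hstep
    obtain ⟨f, hf, m, hm⟩ := ih
    exact ⟨_, hf.cons, m + 1, hm⟩

/-- Some infinite walk from `v` visits `s` at time `N` or later, and visits `b`. -/
def HasLateWalk {V E : Type} (src tgt : E → V) (s b : V) (N : ℕ) (v : V) : Prop :=
  ∃ f, IsInfWalk src tgt v f ∧ (∃ n, N ≤ n ∧ src (f n) = s) ∧ ∃ m, src (f m) = b

theorem HasLateWalk.of_step {V E : Type} {src tgt : E → V} {s b u v : V} {N : ℕ}
    (h : HasLateWalk src tgt s b N v) (huv : Step src tgt u v) :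
    HasLateWalk src tgt s b (N + 1) u := by
  obtain ⟨e, rfl, rfl⟩ := huv
  obtain ⟨f, hf, ⟨n, hNn, hn⟩, m, hm⟩ := h
  exact ⟨_, hf.cons, ⟨n + 1, Nat.succ_le_succ hNn, hn⟩, m + 1, hm⟩

theorem HasLateWalk.mono {V E : Type} {src tgt : E → V} {s b v : V} {M N : ℕ} (hMN : M ≤ N)
    (h : HasLateWalk src tgt s b N v) : HasLateWalk src tgt s b M v := by
  obtain ⟨f, hf, ⟨n, hNn, hn⟩, hm⟩ := h
  exact ⟨f, hf, ⟨n, hMN.trans hNn, hn⟩, hm⟩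

theorem HasLateWalk.of_reaches {V E : Type} {src tgt : E → V} {s b u v : V} {N : ℕ}
    (h : HasLateWalk src tgt s b N v) (huv : Reaches src tgt u v) :
    HasLateWalk src tgt s b N u := by
  induction huv using Relation.ReflTransGen.head_induction_on with
  | refl => exact h
  | head hstep _ ih => exact (ih.of_step hstep).mono N.le_succ

/-- If `s` lies on a closed walk and reaches `b`, where an infinite walk starts, then infinite walks
from `s` through `b` can visit `s` arbitrarily late. -/
theorem hasLateWalk_of_transGen_self {V E : Type} {src tgt : E → V} {s b : V}
    (hs : Relation.TransGen (Step src tgt) s s) (hsb : Reaches src tgt s b)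
    {g : ℕ → E} (hg : IsInfWalk src tgt b g) (N : ℕ) : HasLateWalk src tgt s b N s := by
  induction N with
  | zero =>
    obtain ⟨f, hf, hm⟩ := hsb.exists_isInfWalk hg
    exact ⟨f, hf, ⟨0, le_rfl, hf.1⟩, hm⟩
  | succ N ih =>
    obtain ⟨t, hst, hts⟩ := Relation.TransGen.head'_iff.1 hs
    exact (ih.of_reaches hts).of_step hst

/-- **Proposition 5.3(2)**: if `p` reaches a circuit `c₁` which reaches a circuit `c₂`
through a vertex `b` that cannot return to `c₁`, then there are infinitely many
infinite walks starting at `p`. -/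
theorem infinitely_many_walks_of_cascade_of_circuits
    {V E : Type} [Finite V] [Finite E] (src tgt : E → V) (p : V)
    (c₁ c₂ : Circuit src tgt) (a b : V)
    (ha : a ∈ c₁.verts) (hb : b ∈ c₂.verts)
    (hpa : Reaches src tgt p a)
    (hab : ∃ v ∈ c₁.verts, Reaches src tgt v b)
    (hnb : ∀ v ∈ c₁.verts, ¬ Reaches src tgt b v) :
    {f : ℕ → E | IsInfWalk src tgt p f}.Infinite := by
  obtain ⟨s, hs, hsb⟩ := hab
  obtain ⟨g, hg, -⟩ := c₂.exists_isInfWalk hb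
  have hlate (N : ℕ) : HasLateWalk src tgt s b N p :=
    (hasLateWalk_of_transGen_self (c₁.transGen hs hs) hsb hg N).of_reaches
      (hpa.trans (c₁.transGen ha hs).to_reflTransGen)
  choose f hf hvisit_s hvisit_b using hlate
  choose n hNn hn using hvisit_s
  choose m hm using hvisit_b
  intro hfin
  have hrange : (Set.range f).Finite := hfin.subset (Set.range_subset_iff.2 hf)
  obtain ⟨K, hK⟩ : ∃ K, (f ⁻¹' {f K}).Infinite := by
    by_contra! h
    refine Set.infinite_univ (α := ℕ) ((hrange.biUnion (t := fun x => f ⁻¹' {x}) ?_).subset ?_)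
    · rintro _ ⟨K, rfl⟩
      exact h K
    · exact fun N _ => Set.mem_biUnion (Set.mem_range_self N) rfl
  obtain ⟨N, hN, hmN⟩ := hK.exists_gt (m K)
  have hfN : f N = f K := hN
  have h := (hf N).reaches (hmN.le.trans (hNn N))
  rw [hn, hfN, hm] at h
  exact hnb s hs h
end

section
/- Proposition 5.3(3): Let G be a finite directed multigraph and p a vertex. Suppose there are circuits c₀ and c₁ of G and vertices q₀ on c₀ but not on c₁ and q₁ on c₁ but not on c₀ such that q₀ reaches q₁, q₁ reaches q₀, and p reaches q₀. Then the set of infinite walks starting at p is uncountable. -/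
/-- There is a walk with exactly `n` edges from `u` to `v`. -/
def ReachesIn {V E : Type} (src tgt : E → V) (v : V) : ℕ → V → Prop
  | 0, u => u = v
  | n + 1, u => ∃ e : E, src e = u ∧ ReachesIn src tgt v n (tgt e)

theorem Reaches.exists_reachesIn {V E : Type} {src tgt : E → V} {u v : V}
    (h : Reaches src tgt u v) : ∃ n, ReachesIn src tgt v n u := by
  induction h using Relation.ReflTransGen.head_induction_on with
  | refl => exact ⟨0, rfl⟩
  | head hs _ ih =>
    obtain ⟨e, he, rfl⟩ := hs
    obtain ⟨n, hn⟩ := ih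
    exact ⟨n + 1, e, he, hn⟩

theorem ReachesIn.reaches {V E : Type} {src tgt : E → V} {v : V} :
    ∀ {n : ℕ} {u : V}, ReachesIn src tgt v n u → Reaches src tgt u v
  | 0, _, h => by
    cases h
    exact Relation.ReflTransGen.refl
  | _ + 1, _, ⟨e, he, h⟩ => Relation.ReflTransGen.head ⟨e, he, rfl⟩ h.reaches

/-- The length of a shortest walk from `u` to `v` strictly decreases along a suitable edge. -/
theorem exists_potential {V E : Type} (src tgt : E → V) (v : V) :
    ∃ d : V → ℕ, ∀ u, Reaches src tgt u v → u ≠ v →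
      ∃ e : E, src e = u ∧ Reaches src tgt (tgt e) v ∧ d (tgt e) < d u := by
  refine ⟨fun u => sInf {n | ReachesIn src tgt v n u}, fun u hu huv => ?_⟩
  have hmin : ReachesIn src tgt v (sInf {n | ReachesIn src tgt v n u}) u :=
    Nat.sInf_mem hu.exists_reachesIn
  dsimp only
  generalize sInf {n | ReachesIn src tgt v n u} = m at hmin
  cases m with
  | zero => exact absurd hmin huv
  | succ n =>
    obtain ⟨e, he, hn⟩ := hmin
    exact ⟨e, he, hn.reaches, Nat.lt_succ_of_le (Nat.sInf_le hn)⟩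

/-- If `p` reaches a vertex `v` with two distinct outgoing edges from both of which one can return
to `v`, then any sequence of edge sequences misses some infinite walk from `p`: follow a shortest
walk to `v` over and over, and on the `k`-th visit leave along an edge other than the one used at
that time by the `k`-th sequence. -/
theorem exists_infWalk_forall_ne {V E : Type} {src tgt : E → V} {p v : V} {e e' : E}
    (hne : e ≠ e') (he : src e = v) (he' : src e' = v)
    (hr : Reaches src tgt (tgt e) v) (hr' : Reaches src tgt (tgt e') v)
    (hp : Reaches src tgt p v) (g : ℕ → ℕ → E) :
    ∃ f, IsInfWalk src tgt p f ∧ ∀ k, f ≠ g k := by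
  classical
  obtain ⟨d, hd⟩ := exists_potential src tgt v
  have hd' : ∀ u, ∃ a : E, Reaches src tgt u v → u ≠ v →
      src a = u ∧ Reaches src tgt (tgt a) v ∧ d (tgt a) < d u := by
    intro u
    by_cases h : Reaches src tgt u v ∧ u ≠ v
    · obtain ⟨a, ha⟩ := hd u h.1 h.2
      exact ⟨a, fun _ _ => ha⟩
    · exact ⟨e, fun h₁ h₂ => absurd ⟨h₁, h₂⟩ h⟩
  choose next hnext using hd'
  let out : V × ℕ → ℕ → E := fun s n =>
    if s.1 = v then (if g s.2 n = e then e' else e) else next s.1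
  let state : ℕ → V × ℕ := fun n => Nat.rec (p, 0)
    (fun n s => (tgt (out s n), if s.1 = v then s.2 + 1 else s.2)) n
  have hstate : ∀ n, state (n + 1) =
      (tgt (out (state n) n), if (state n).1 = v then (state n).2 + 1 else (state n).2) :=
    fun _ => rfl
  have hout : ∀ s n, Reaches src tgt s.1 v →
      src (out s n) = s.1 ∧ Reaches src tgt (tgt (out s n)) v := by
    intro s n hs
    by_cases h : s.1 = v
    · by_cases h' : g s.2 n = e
      · simp [out, h, h', he', hr']
      · simp [out, h, h', he, hr]
    · simpa [out, h] using ⟨(hnext _ hs h).1, (hnext _ hs h).2.1⟩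
  have hlive : ∀ n, Reaches src tgt (state n).1 v := by
    intro n
    induction n with
    | zero => exact hp
    | succ n ih => exact (hout _ n ih).2
  have hreturn : ∀ m n, d (state n).1 = m → ∃ n', state n' = (v, (state n).2) := by
    intro m
    induction m using Nat.strong_induction_on with
    | _ m ih =>
      intro n hn
      by_cases h : (state n).1 = v
      · exact ⟨n, Prod.ext h rfl⟩
      · have hs : state (n + 1) = (tgt (next (state n).1), (state n).2) := by
          simp [hstate, out, h]
        have hlt := (hnext _ (hlive n) h).2.2
        obtain ⟨n', hn'⟩ := ih _ (hn ▸ hlt) (n + 1) (by rw [hs])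
        exact ⟨n', by rw [hn', hs]⟩
  have hvisit : ∀ k, ∃ n, state n = (v, k) := by
    intro k
    induction k with
    | zero => exact hreturn _ 0 rfl
    | succ k ih =>
      obtain ⟨n, hn⟩ := ih
      obtain ⟨n', hn'⟩ := hreturn _ (n + 1) rfl
      exact ⟨n', by rw [hn', hstate, hn]; simp⟩
  refine ⟨fun n => out (state n) n, ⟨(hout _ 0 (hlive 0)).1, fun n => ?_⟩, fun k hk => ?_⟩
  · exact (hout _ (n + 1) (hlive (n + 1))).1.symm
  · obtain ⟨n, hn⟩ := hvisit k
    have h := congrFun hk n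
    by_cases h' : g k n = e
    · simp only [hn, out, h', if_true] at h
      exact hne h.symm
    · simp only [hn, out, h', if_true, if_false] at h
      exact h' h.symm

theorem List.IsChain.reaches_and_mem {V E : Type} {src tgt : E → V} {l : List E}
    (hl : l.IsChain fun e f => tgt e = src f) (hne : l ≠ []) {a : E} (ha : a ∈ l) :
    Reaches src tgt (src (l.head hne)) (src a) ∧
      Reaches src tgt (tgt a) (tgt (l.getLast hne)) ∧
      (tgt a ∈ l.map src ∨ tgt a = tgt (l.getLast hne)) := by
  induction l generalizing a with
  | nil => exact absurd rfl hne
  | cons b l ih =>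
    cases l with
    | nil =>
      obtain rfl : a = b := by simpa using ha
      exact ⟨.refl, .refl, .inr rfl⟩
    | cons c l =>
      obtain ⟨hbc, hl⟩ := List.isChain_cons_cons.1 hl
      have hc := ih hl (List.cons_ne_nil _ _) (List.mem_cons_self (a := c) (l := l))
      rw [List.getLast_cons (List.cons_ne_nil c l)]
      rcases List.mem_cons.1 ha with rfl | ha
      · refine ⟨.refl, ?_, .inl (by simp [hbc])⟩
        rw [hbc]
        exact .head ⟨c, rfl, rfl⟩ hc.2.1
      · obtain ⟨h₁, h₂, h₃⟩ := ih hl (List.cons_ne_nil _ _) ha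
        refine ⟨.head ⟨b, rfl, hbc⟩ h₁, h₂, h₃.imp_left fun h => ?_⟩
        exact List.mem_cons_of_mem _ h

theorem Circuit.tgt_mem_verts_and_reaches {V E : Type} {src tgt : E → V} (c : Circuit src tgt)
    {a : E} (ha : a ∈ c.edges) : tgt a ∈ c.verts ∧ Reaches src tgt (tgt a) (src a) := by
  obtain ⟨h₁, h₂, h₃⟩ := List.IsChain.reaches_and_mem c.chain c.ne ha
  rw [c.closed] at h₂ h₃
  refine ⟨h₃.elim id fun h => ?_, h₂.trans h₁⟩
  rw [h]
  exact List.mem_map_of_mem (List.head_mem c.ne)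

/-- A walk leaving a set of vertices uses an edge that leaves it. -/
theorem Reaches.exists_exit {V E : Type} {src tgt : E → V} {u w : V} {S : Set V}
    (h : Reaches src tgt u w) (hu : u ∈ S) (hw : w ∉ S) :
    ∃ e : E, src e ∈ S ∧ tgt e ∉ S ∧ Reaches src tgt u (src e) ∧ Reaches src tgt (tgt e) w := by
  induction h using Relation.ReflTransGen.head_induction_on with
  | refl => exact absurd hu hw
  | @head a b hs hbw ih =>
    by_cases hb : b ∈ S
    · obtain ⟨e, h₁, h₂, h₃, h₄⟩ := ih hb
      exact ⟨e, h₁, h₂, .head hs h₃, h₄⟩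
    · obtain ⟨e, rfl, rfl⟩ := hs
      exact ⟨e, hu, hb, .refl, hbw⟩

/-- **Proposition 5.3(3)**: if `p` reaches two linked circuits, then the set of infinite
walks starting at `p` is uncountable. -/
theorem uncountably_many_walks_of_linked_circuits
    {V E : Type} [Finite V] [Finite E] (src tgt : E → V) (p : V)
    (c₀ c₁ : Circuit src tgt) (q₀ q₁ : V)
    (h₀ : q₀ ∈ c₀.verts) (h₀' : q₀ ∉ c₁.verts)
    (h₁ : q₁ ∈ c₁.verts) (h₁' : q₁ ∉ c₀.verts)
    (h01 : Reaches src tgt q₀ q₁) (h10 : Reaches src tgt q₁ q₀)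
    (hp : Reaches src tgt p q₀) :
    ¬ {f : ℕ → E | IsInfWalk src tgt p f}.Countable := by
  obtain ⟨e, heS, heT, hq₀e, heq₁⟩ := h01.exists_exit (S := {x | x ∈ c₀.verts}) h₀ h₁'
  obtain ⟨e', he', hsrc⟩ := List.mem_map.1 heS
  obtain ⟨hmem, hback⟩ := c₀.tgt_mem_verts_and_reaches he'
  rw [hsrc] at hback
  have hne : e ≠ e' := by
    rintro rfl
    exact heT hmem
  intro hcount
  have : Nonempty (ℕ → E) := ⟨fun _ => e⟩
  obtain ⟨g, hg⟩ := Set.countable_iff_exists_subset_range.1 hcount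
  obtain ⟨f, hf, hfg⟩ := exists_infWalk_forall_ne hne rfl hsrc
    ((heq₁.trans h10).trans hq₀e) hback (hp.trans hq₀e) g
  obtain ⟨k, hk⟩ := hg hf
  exact hfg k hk.symm
end

section
/- Combinatorial core of Propositions 6.13 and 6.14 (cyclic vertices of outdegree one): Let G be a finite directed multigraph in which every vertex lying on some circuit has at most one outgoing edge. Then for every vertex p of G, the set of infinite walks starting at p is finite. -/
/-- A walk segment from index `i` to index `j` that closes up for the first time is a circuit. -/
def IsInfWalk.circuit {V E : Type} {src tgt : E → V} {p : V} {f : ℕ → E}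
    (hf : IsInfWalk src tgt p f) {i j : ℕ} (hij : i < j) (hclosed : src (f i) = src (f j))
    (hinj : Set.InjOn (fun n => src (f n)) (Set.Iio j)) : Circuit src tgt where
  edges := (List.range' i (j - i)).map f
  ne := by simp; omega
  chain := by
    refine List.isChain_iff_getElem.mpr ?_
    intro k hk
    simpa [add_assoc] using hf.2 (i + k)
  closed := by
    rw [List.getLast_eq_getElem, List.head_eq_getElem]
    have hlast : i + (j - i - 1) + 1 = j := by omega
    simpa [hlast, hclosed] using hf.2 (i + (j - i - 1))
  nodup := by
    rw [List.map_map]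
    refine List.Nodup.map_on (fun a ha b hb hab => hinj ?_ ?_ hab) List.nodup_range'
    · simp only [List.mem_range'_1] at ha
      simp only [Set.mem_Iio]
      omega
    · simp only [List.mem_range'_1] at hb
      simp only [Set.mem_Iio]
      omega

/-- An infinite walk in a finite multigraph repeats a vertex within its first `Nat.card V` steps,
and up to the first repetition its vertices are pairwise distinct. -/
theorem exists_first_repetition {V : Type} [Finite V] (u : ℕ → V) :
    ∃ i j : ℕ, i < j ∧ j ≤ Nat.card V ∧ u i = u j ∧ Set.InjOn u (Set.Iio j) := by
  classical
  have hex : ∃ j, ∃ i < j, u i = u j := by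
    obtain ⟨a, b, hab, hu⟩ := Finite.exists_ne_map_eq_of_infinite u
    rcases hab.lt_or_gt with hlt | hlt
    · exact ⟨b, a, hlt, hu⟩
    · exact ⟨a, b, hlt, hu.symm⟩
  obtain ⟨i, hij, hu⟩ := Nat.find_spec hex
  have hinj : Set.InjOn u (Set.Iio (Nat.find hex)) := by
    intro a ha b hb hab
    rcases lt_trichotomy a b with hlt | heq | hlt
    · exact (Nat.find_min hex hb ⟨a, hlt, hab⟩).elim
    · exact heq
    · exact (Nat.find_min hex ha ⟨b, hlt, hab.symm⟩).elim
  refine ⟨i, Nat.find hex, hij, ?_, hu, hinj⟩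
  have hcard := Nat.card_le_card_of_injective _ hinj.injective
  simpa using hcard

/-- If vertices on circuits have outdegree at most one, then so have all vertices that an infinite
walk visits after at least `Nat.card V` steps. -/
theorem IsInfWalk.subsingleton_of_card_le {V E : Type} [Finite V] {src tgt : E → V}
    (h : ∀ c : Circuit src tgt, ∀ v ∈ c.verts, {e : E | src e = v}.Subsingleton)
    {p : V} {f : ℕ → E} (hf : IsInfWalk src tgt p f) {n : ℕ} (hn : Nat.card V ≤ n) :
    {e : E | src e = src (f n)}.Subsingleton := by
  obtain ⟨i, j, hij, hj, hclosed, hinj⟩ := exists_first_repetition fun n => src (f n)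
  have hsub : ∀ m, i ≤ m → m < j → {e : E | src e = src (f m)}.Subsingleton := by
    intro m him hmj
    refine h (hf.circuit hij hclosed hinj) _ (List.mem_map_of_mem (List.mem_map_of_mem ?_))
    rw [List.mem_range'_1]
    omega
  have hvisit : ∀ n, i ≤ n → ∃ m, i ≤ m ∧ m < j ∧ src (f n) = src (f m) := by
    intro n hin
    induction n, hin using Nat.le_induction with
    | base => exact ⟨i, le_rfl, hij, rfl⟩
    | succ n _ ih =>
      obtain ⟨m, him, hmj, hnm⟩ := ih
      have hedge : f n = f m := hsub m him hmj hnm rfl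
      have hsrc : src (f (n + 1)) = src (f (m + 1)) := by
        rw [← hf.2 n, ← hf.2 m, hedge]
      rcases (Nat.succ_le_of_lt hmj).lt_or_eq with hlt | heq
      · exact ⟨m + 1, by omega, hlt, hsrc⟩
      · refine ⟨i, le_rfl, hij, hsrc.trans ?_⟩
        rw [← Nat.succ_eq_add_one, heq]
        exact hclosed.symm
  obtain ⟨m, him, hmj, hnm⟩ := hvisit n (by omega)
  rw [hnm]
  exact hsub m him hmj

/-- Combinatorial core of **Propositions 6.13 and 6.14**: if every vertex lying on a
circuit has at most one outgoing edge, then every vertex has only finitely many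
infinite walks starting from it. -/
theorem finitely_many_walks_of_cyclic_outdegree_one
    {V E : Type} [Finite V] [Finite E] (src tgt : E → V)
    (h : ∀ c : Circuit src tgt, ∀ v ∈ c.verts, {e : E | src e = v}.Subsingleton) :
    ∀ p : V, {f : ℕ → E | IsInfWalk src tgt p f}.Finite := by
  intro p
  refine Set.Finite.of_injOn (f := fun f (k : Fin (Nat.card V + 1)) => f k)
    (Set.mapsTo_univ _ _) ?_ Set.finite_univ
  intro f hf g hg hfg
  funext n
  induction n with
  | zero => exact congrFun hfg 0
  | succ n ih =>
    by_cases hn : n + 1 < Nat.card V + 1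
    · exact congrFun hfg ⟨n + 1, hn⟩
    · refine IsInfWalk.subsingleton_of_card_le h hf (n := n + 1) (by omega) rfl ?_
      change src (g (n + 1)) = src (f (n + 1))
      rw [← hf.2 n, ← hg.2 n, ih]
end

section
/- Proposition 5.2(1): Let K be the attractor of a system of injective contractions S_i (i ∈ I) on a complete metric space, suppose K is a dendrite and the self-similar boundary ∂K is finite. Then for every x ∈ K that has exactly one address, the number of connected components of K \ {x} is at most the cardinality of ∂K. -/
section SelfSimilar

variable {X : Type*} {m : ℕ} {S : Fin m → X → X} {K : Set X}

theorem sWord_mem (hK : K = ⋃ i, S i '' K) (w : List (Fin m)) {z : X} (hz : z ∈ K) :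
    SWord S w z ∈ K := by
  induction w with
  | nil => exact hz
  | cons i w ih =>
    rw [hK]
    exact Set.mem_iUnion.2 ⟨i, _, ih, rfl⟩

theorem exists_mem_image_sWord (hK : K = ⋃ i, S i '' K) (n : ℕ) {y : X} (hy : y ∈ K) :
    ∃ w : List (Fin m), w.length = n ∧ y ∈ SWord S w '' K := by
  induction n generalizing y with
  | zero => exact ⟨[], rfl, y, hy, rfl⟩
  | succ n ih =>
    rw [hK] at hy
    obtain ⟨i, z, hz, rfl⟩ := Set.mem_iUnion.1 hy
    obtain ⟨w, hw, u, hu, rfl⟩ := ih hz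
    exact ⟨i :: w, by simp [hw], u, hu, rfl⟩

theorem exists_isAddress (hK : K = ⋃ i, S i '' K) {y : X} (hy : y ∈ K) :
    ∃ β, IsAddress S K y β := by
  have key : ∀ y : K, ∃ (i : Fin m) (z : K), S i z = y := by
    rintro ⟨y, hy⟩
    rw [hK] at hy
    obtain ⟨i, z, hz, rfl⟩ := Set.mem_iUnion.1 hy
    exact ⟨i, ⟨z, hz⟩, rfl⟩
  choose g h hgh using key
  have iter : ∀ (n : ℕ) (y : K),
      SWord S (List.ofFn fun k : Fin n => g (h^[k.val] y)) (h^[n] y) = y := by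
    intro n
    induction n with
    | zero => intro y; rfl
    | succ n ih =>
      intro y
      rw [List.ofFn_succ]
      change S (g y) (SWord S (List.ofFn fun k : Fin n => g (h^[k.val] (h y))) (h^[n] (h y))) = y
      rw [ih, hgh]
  exact ⟨fun k => g (h^[k] ⟨y, hy⟩), fun n _ => ⟨_, (h^[n] ⟨y, hy⟩).2, iter n ⟨y, hy⟩⟩⟩

theorem exists_isAddress_of_mem_image (hK : K = ⋃ i, S i '' K) (w : List (Fin m)) {y : X}
    (hy : y ∈ SWord S w '' K) :
    ∃ β, IsAddress S K y β ∧ (List.ofFn fun k : Fin w.length => β k.val) = w := by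
  induction w generalizing y with
  | nil =>
    obtain ⟨z, hz, rfl⟩ := hy
    obtain ⟨β, hβ⟩ := exists_isAddress hK hz
    exact ⟨β, hβ, rfl⟩
  | cons i w ih =>
    obtain ⟨z, hz, rfl⟩ := hy
    obtain ⟨γ, hγ, hw⟩ := ih ⟨z, hz, rfl⟩
    refine ⟨fun k => Nat.casesOn k i γ, fun n hn => ?_, ?_⟩
    · obtain ⟨p, rfl⟩ := Nat.exists_eq_add_of_le' hn
      rw [List.ofFn_succ]
      have hp : SWord S w z ∈ SWord S (List.ofFn fun k : Fin p => γ k.val) '' K := by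
        rcases Nat.eq_zero_or_pos p with rfl | hp
        · exact ⟨_, sWord_mem hK w hz, rfl⟩
        · exact hγ p hp
      obtain ⟨u, hu, huz⟩ := hp
      exact ⟨u, hu, congrArg (S i) huz⟩
    · change (List.ofFn fun k : Fin (w.length + 1) => (Nat.casesOn k.val i γ : Fin m)) = i :: w
      rw [List.ofFn_succ]
      exact congrArg (List.cons i) hw

theorem mem_ssBoundary_of_sWord_mem (hK : K = ⋃ i, S i '' K)
    (hinj : ∀ i, Function.Injective (S i)) {v w : List (Fin m)} (hl : w.length = v.length)
    (hne : w ≠ v) {z : X} (hz : z ∈ K) (h : SWord S v z ∈ SWord S w '' K) :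
    z ∈ SSBoundary S K := by
  induction v generalizing w with
  | nil => exact absurd (List.length_eq_zero_iff.1 hl) hne
  | cons j v ih =>
    cases w with
    | nil => simp at hl
    | cons i w =>
      obtain ⟨u, hu, huz⟩ := h
      by_cases hij : i = j
      · subst hij
        exact ih (by simpa using hl) (fun h => hne (by rw [h])) ⟨u, hu, hinj i huz⟩
      · refine ⟨hz, j :: v, List.cons_ne_nil _ _, ?_⟩
        exact Set.mem_iUnion₂.2 ⟨i, j, Set.mem_iUnion.2
          ⟨hij, ⟨_, sWord_mem hK w hu, huz⟩, ⟨_, sWord_mem hK v hz, rfl⟩⟩⟩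

end SelfSimilar

theorem lipschitzWith_sWord {X : Type*} [PseudoEMetricSpace X] {m : ℕ} {S : Fin m → X → X}
    {R : NNReal} (h : ∀ i, LipschitzWith R (S i)) (w : List (Fin m)) :
    LipschitzWith (R ^ w.length) (SWord S w) := by
  induction w with
  | nil => exact LipschitzWith.id
  | cons i w ih =>
    rw [List.length_cons, pow_succ']
    exact (h i).comp ih

open Filter Topology in
theorem eventually_notMem_image_sWord {X : Type*} [MetricSpace X] {m : ℕ} {S : Fin m → X → X}
    {r : Fin m → NNReal} (hr : ∀ i, r i < 1) (hlip : ∀ i, LipschitzWith (r i) (S i))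
    {K : Set X} (hK : Bornology.IsBounded K) {α : ℕ → Fin m} {x y : X} (hα : IsAddress S K x α)
    (hxy : x ≠ y) :
    ∀ᶠ n in atTop, y ∉ SWord S (List.ofFn fun k : Fin n => α k.val) '' K := by
  obtain ⟨R, hR, hrR⟩ : ∃ R : NNReal, R < 1 ∧ ∀ i, r i ≤ R :=
    ⟨Finset.univ.sup r, (Finset.sup_lt_iff zero_lt_one).2 fun i _ => hr i,
      fun i => Finset.le_sup (Finset.mem_univ i)⟩
  obtain ⟨D, hD⟩ := Metric.isBounded_iff.1 hK
  have hlim : Tendsto (fun n : ℕ => (R : ℝ) ^ n * D) atTop (𝓝 0) := by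
    simpa using (tendsto_pow_atTop_nhds_zero_of_lt_one R.2 (by exact_mod_cast hR)).mul_const D
  filter_upwards [hlim.eventually_lt_const (dist_pos.2 hxy), eventually_ge_atTop 1]
    with n hn h1 hy
  obtain ⟨a, ha, hax⟩ := hα n h1
  obtain ⟨b, hb, hby⟩ := hy
  have hd := (lipschitzWith_sWord (fun i => (hlip i).weaken (hrR i))
    (List.ofFn fun k : Fin n => α k.val)).dist_le_mul a b
  rw [hax, hby, List.length_ofFn, NNReal.coe_pow] at hd
  exact absurd (hd.trans (mul_le_mul_of_nonneg_left (hD ha hb) (by positivity))) (not_le.2 hn)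

/-- In a connected locally connected set `K`, every component of `K \ {x}` accumulates at `x`. -/
theorem mem_closure_connectedComponentIn_diff_singleton {X : Type*} [TopologicalSpace X]
    [T1Space X] {K : Set X} [LocallyConnectedSpace K] (hK : IsPreconnected K) {x y : X}
    (hx : x ∈ K) (hy : y ∈ K \ {x}) : x ∈ closure (connectedComponentIn (K \ {x}) y) := by
  have : PreconnectedSpace K := Subtype.preconnectedSpace hK
  let x' : K := ⟨x, hx⟩
  let y' : K := ⟨y, hy.1⟩
  have hy' : y' ∈ ({x'}ᶜ : Set K) := fun h => hy.2 (congrArg Subtype.val h)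
  set C := connectedComponentIn ({x'}ᶜ : Set K) y' with hC
  have hyC : y' ∈ C := mem_connectedComponentIn hy'
  have hsub : Subtype.val '' C ⊆ connectedComponentIn (K \ {x}) y := by
    refine (isPreconnected_connectedComponentIn.image _
      continuous_subtype_val.continuousOn).subset_connectedComponentIn ⟨y', hyC, rfl⟩ ?_
    rintro _ ⟨z, hz, rfl⟩
    exact ⟨z.2, fun h => connectedComponentIn_subset _ _ hz (Subtype.ext h)⟩
  have hxC : x' ∈ closure C := by
    by_contra hxC
    have hcl : closure C ⊆ C :=
      isPreconnected_connectedComponentIn.closure.subset_connectedComponentIn (subset_closure hyC)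
        fun z hz h => hxC (h ▸ hz)
    have hclopen : IsClopen C :=
      ⟨isClosed_of_closure_subset hcl, isOpen_compl_singleton.connectedComponentIn⟩
    have : x' ∈ C := (hclopen.eq_univ ⟨y', hyC⟩) ▸ Set.mem_univ _
    exact hxC (subset_closure this)
  exact closure_mono hsub (image_closure_subset_closure_image continuous_subtype_val
    ⟨x', hxC, rfl⟩)

/-- **Proposition 5.2(1)**: in a self-similar dendrite with finite self-similar
boundary, a point with exactly one address has order at most `#∂K`. -/
theorem ord_le_card_boundary_of_unique_address
    {X : Type*} [MetricSpace X] [CompleteSpace X] {m : ℕ}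
    (S : Fin m → X → X) (r : Fin m → NNReal) (hr : ∀ i, r i < 1)
    (hlip : ∀ i, LipschitzWith (r i) (S i)) (hinj : ∀ i, Function.Injective (S i))
    (K : Set X) (hKne : K.Nonempty) (hKcp : IsCompact K) (hKeq : K = ⋃ i, S i '' K)
    (hdend : IsDendrite K) (hfin : (SSBoundary S K).Finite)
    (x : X) (hx : x ∈ K) (huniq : ∃! α : ℕ → Fin m, IsAddress S K x α) :
    Cardinal.mk ↥(ComponentsIn (K \ {x})) ≤ Cardinal.mk ↥(SSBoundary S K) := by
  obtain ⟨-, hconn, hloc, -⟩ := hdend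
  obtain ⟨α, hα, hαu⟩ := huniq
  have hcont : ∀ w, Continuous (SWord S w) := fun w => by
    induction w with
    | nil => exact continuous_id
    | cons i w ih => exact (hlip i).continuous.comp ih
  have hclosed : ∀ w, IsClosed (SWord S w '' K) := fun w => (hKcp.image (hcont w)).isClosed
  rw [← Set.cast_ncard hfin, Cardinal.mk_le_iff_forall_finset_subset_card_le]
  intro T hT
  have : Nonempty X := ⟨x⟩
  have hT' : ∀ Q ∈ T, ∃ y ∈ K \ {x}, Q = connectedComponentIn (K \ {x}) y := fun Q hQ => hT hQ
  choose! y hyK hyT using hT'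
  have hev := (Filter.eventually_all_finset T).2 fun Q hQ =>
    eventually_notMem_image_sWord hr hlip hKcp.isBounded hα (Ne.symm (hyK Q hQ).2)
  obtain ⟨n, hn, hn1⟩ := (hev.and (Filter.eventually_ge_atTop 1)).exists
  set v := List.ofFn fun k : Fin n => α k.val with hv
  have hvl : v.length = n := List.length_ofFn
  let B : Set X := ⋃ w ∈ {w : List (Fin m) | w.length = n ∧ w ≠ v}, SWord S w '' K
  have hB : IsClosed B :=
    ((List.finite_length_eq (Fin m) n).subset fun w hw => hw.1).isClosed_biUnion
      fun w _ => hclosed w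
  have hcover : K ⊆ SWord S v '' K ∪ B := fun z hz => by
    obtain ⟨w, hw, hzw⟩ := exists_mem_image_sWord hKeq n hz
    by_cases h : w = v
    · exact Or.inl (h ▸ hzw)
    · exact Or.inr (Set.mem_biUnion (show w ∈ {w | w.length = n ∧ w ≠ v} from ⟨hw, h⟩) hzw)
  have hxB : x ∉ B := fun h => by
    obtain ⟨w, ⟨rfl, hwv⟩, hxw⟩ := Set.mem_iUnion₂.1 h
    obtain ⟨β, hβ, hβw⟩ := exists_isAddress_of_mem_image hKeq w hxw
    exact hwv (by rw [hv, ← hαu β hβ, hβw])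
  have hpt : ∀ Q ∈ T, ∃ z ∈ SSBoundary S K, SWord S v z ∈ Q := by
    intro Q hQ
    have hQK : Q ⊆ K \ {x} := hyT Q hQ ▸ connectedComponentIn_subset _ _
    have hyQ : y Q ∈ Q := (hyT Q hQ).symm.subset (mem_connectedComponentIn (hyK Q hQ))
    have hQc : IsPreconnected Q := hyT Q hQ ▸ isPreconnected_connectedComponentIn
    have hxQ : x ∈ closure Q := by
      rw [hyT Q hQ]
      exact mem_closure_connectedComponentIn_diff_singleton hconn.isPreconnected hx (hyK Q hQ)
    obtain ⟨a, haB, haQ⟩ := mem_closure_iff.1 hxQ _ hB.isOpen_compl hxB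
    obtain ⟨p, hpQ, ⟨z, hz, rfl⟩, hpB⟩ := isPreconnected_closed_iff.1 hQc _ _ (hclosed v) hB
      (fun z hz => hcover (hQK hz).1)
      ⟨a, haQ, (hcover (hQK haQ).1).resolve_right haB⟩
      ⟨y Q, hyQ, (hcover (hyK Q hQ).1).resolve_left (hn Q hQ)⟩
    obtain ⟨w, ⟨hwl, hwv⟩, hpw⟩ := Set.mem_iUnion₂.1 hpB
    exact ⟨z, mem_ssBoundary_of_sWord_mem hKeq hinj (hwl.trans hvl.symm) hwv hz hpw, hpQ⟩
  choose! z hzB hzQ using hpt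
  rw [Set.ncard_eq_toFinset_card _ hfin]
  refine Finset.card_le_card_of_injOn z (fun Q hQ => hfin.mem_toFinset.2 (hzB Q hQ)) ?_
  intro Q hQ Q' hQ' h
  have h1 : SWord S v (z Q) ∈ connectedComponentIn (K \ {x}) (y Q) := hyT Q hQ ▸ hzQ Q hQ
  have h2 : SWord S v (z Q) ∈ connectedComponentIn (K \ {x}) (y Q') := by
    rw [← hyT Q' hQ', h]
    exact hzQ Q' hQ'
  rw [hyT Q hQ, hyT Q' hQ', connectedComponentIn_eq h1, connectedComponentIn_eq h2]
end
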